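/- Let Ω ⊂ ℝ² be a simply connected open set and let σ be a 2×2 matrix field on Ω with entries locally Hölder continuous of exponent α ∈ (0,1), satisfying the uniform ellipticity conditions σ(x)ξ·ξ ≥ K⁻¹|ξ|² and σ⁻¹(x)ξ·ξ ≥ K⁻¹|ξ|² for every ξ ∈ ℝ² and x ∈ Ω, for some constant K ≥ 1. Let U = (u¹,u²) ∈ W^{1,2}_loc(Ω,ℝ²) satisfy div(σ∇uⁱ) = 0 weakly in Ω for i = 1,2. If U is locally a homeomorphism, then U is locally a diffeomorphism; in particular det DU(x) ≠ 0 for every x ∈ Ω. -/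

import Mathlib

open MeasureTheory Set
open scoped Topology NNReal

noncomputable section

/-- The plane `ℝ²`. -/
abbrev E2 : Type := EuclideanSpace ℝ (Fin 2)

/-- The standard basis vectors of `ℝ²`. -/
def e2 (i : Fin 2) : E2 := EuclideanSpace.single i (1 : ℝ)

/-- A smooth test function compactly supported inside `Ω`. -/
def IsTestOn (Ω : Set E2) (φ : E2 → ℝ) : Prop :=
  ContDiff ℝ (⊤ : ℕ∞) φ ∧ HasCompactSupport φ ∧ tsupport φ ⊆ Ω

namespace SH
open Filter

/-- Cutoff functions. -/
lemma exists_cutoff {E : Type*} [NormedAddCommGroup E] [NormedSpace ℝ E] [FiniteDimensional ℝ E]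
    {K O : Set E} (hK : IsCompact K) (hO : IsOpen O) (hKO : K ⊆ O) :
    ∃ η : E → ℝ, ContDiff ℝ 1 η ∧ HasCompactSupport η ∧ tsupport η ⊆ O ∧
      ∀ᶠ x in 𝓝ˢ K, η x = 1 := by
  obtain ⟨L, hL, hKL, hLO⟩ := exists_compact_between hK hO hKO
  obtain ⟨η, h1, h0, -⟩ := exists_contMDiffMap_one_nhds_of_subset_interior (n := 1)
    (modelWithCornersSelf ℝ E) hK.isClosed hKL
  have hts : tsupport η ⊆ L := by
    apply closure_minimal _ hL.isClosed
    intro x hx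
    by_contra hxL
    exact hx (h0 x hxL)
  refine ⟨η, contMDiff_iff_contDiff.1 η.contMDiff, ?_, hts.trans hLO, h1⟩
  exact HasCompactSupport.of_support_subset_isCompact hL ((subset_tsupport _).trans hts)

lemma contDiff_extend {E : Type*} [NormedAddCommGroup E] [NormedSpace ℝ E]
    {O K : Set E} (hO : IsOpen O) (hK : IsClosed K) (hKO : K ⊆ O) {g : E → ℝ}
    (hg : ContDiffOn ℝ 1 g O) (h0 : ∀ x, x ∉ K → g x = 0) : ContDiff ℝ 1 g := by
  rw [contDiff_iff_contDiffAt]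
  intro x
  by_cases hx : x ∈ O
  · exact hg.contDiffAt (hO.mem_nhds hx)
  · have : g =ᶠ[𝓝 x] fun _ => 0 := by
      filter_upwards [hK.isOpen_compl.mem_nhds (fun h => hx (hKO h))] with y hy
      exact h0 y hy
    exact contDiffAt_const.congr_of_eventuallyEq this

/-- Equality of mixed second derivatives in weak form, for compactly supported functions. -/
lemma integral_cross_aux {ψ u : ℂ → ℝ} (hψ : ContDiff ℝ 1 ψ) (hψc : HasCompactSupport ψ)
    (hu : ContDiff ℝ 1 u) (huc : HasCompactSupport u) (v w : ℂ) :
    ∫ z, fderiv ℝ ψ z v * fderiv ℝ u z w = ∫ z, fderiv ℝ ψ z w * fderiv ℝ u z v := by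
  obtain ⟨C, hC⟩ := hu.lipschitzWith_of_hasCompactSupport huc (by simp)
  obtain ⟨D, hD⟩ := hψ.lipschitzWith_of_hasCompactSupport hψc (by simp)
  have ldψ : ∀ x y, lineDeriv ℝ ψ x y = fderiv ℝ ψ x y := fun x y =>
    (hψ.differentiable (by simp)).differentiableAt.lineDeriv_eq_fderiv
  have ldu : ∀ x y, lineDeriv ℝ u x y = fderiv ℝ u x y := fun x y =>
    (hu.differentiable (by simp)).differentiableAt.lineDeriv_eq_fderiv
  have cψ : ∀ y, Continuous fun x => fderiv ℝ ψ x y := fun y =>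
    (hψ.continuous_fderiv (by simp)).clm_apply continuous_const
  have cu : ∀ y, Continuous fun x => fderiv ℝ u x y := fun y =>
    (hu.continuous_fderiv (by simp)).clm_apply continuous_const
  have kψ : ∀ y, HasCompactSupport fun x => fderiv ℝ ψ x y := fun y => hψc.fderiv_apply ℝ y
  have ku : ∀ y, HasCompactSupport fun x => fderiv ℝ u x y := fun y => huc.fderiv_apply ℝ y
  have T1 := hC.integral_inv_smul_sub_mul_tendsto_integral_lineDeriv_mul (μ := volume)
    ((cψ v).integrable_of_hasCompactSupport (kψ v)) w
  have T2 := hD.integral_inv_smul_sub_mul_tendsto_integral_lineDeriv_mul (μ := volume)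
    ((cu v).integrable_of_hasCompactSupport (ku v)) (-w)
  have key : ∀ t : ℝ, ∫ x, (t⁻¹ • (u (x + t • w) - u x)) * fderiv ℝ ψ x v =
      - ∫ x, (t⁻¹ • (ψ (x + t • (-w)) - ψ x)) * fderiv ℝ u x v := by
    intro t
    have hsh : ContDiff ℝ 1 fun x => u (x + t • w) := hu.comp (contDiff_id.add contDiff_const)
    have hshc : HasCompactSupport fun x => u (x + t • w) :=
      huc.comp_homeomorph (Homeomorph.addRight (t • w))
    have e1 : ∀ {a : ℂ → ℝ}, ContDiff ℝ 1 a → HasCompactSupport a →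
        ∫ x, a x * fderiv ℝ ψ x v = - ∫ x, fderiv ℝ a x v * ψ x := by
      intro a ha hac
      obtain ⟨A, hA⟩ := ha.lipschitzWith_of_hasCompactSupport hac (by simp)
      have := hD.integral_lineDeriv_mul_eq (μ := volume) hA hac v
      simp only [ldψ] at this
      simp only [(ha.differentiable (by simp)).differentiableAt.lineDeriv_eq_fderiv, map_neg,
        neg_mul, integral_neg] at this
      rw [← this]
      simp only [mul_comm]
    have i1 : Integrable fun x => u (x + t • w) * fderiv ℝ ψ x v :=
      (hsh.continuous.mul (cψ v)).integrable_of_hasCompactSupport ((kψ v).mul_left)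
    have i2 : Integrable fun x => u x * fderiv ℝ ψ x v :=
      (hu.continuous.mul (cψ v)).integrable_of_hasCompactSupport ((kψ v).mul_left)
    have i3 : Integrable fun x => ψ (x + t • (-w)) * fderiv ℝ u x v := by
      refine Continuous.integrable_of_hasCompactSupport
        (Continuous.mul (hψ.continuous.comp (by fun_prop)) (cu v)) ((ku v).mul_left)
    have i4 : Integrable fun x => ψ x * fderiv ℝ u x v :=
      (hψ.continuous.mul (cu v)).integrable_of_hasCompactSupport ((ku v).mul_left)
    simp only [smul_eq_mul, mul_assoc, sub_mul]
    rw [integral_const_mul, integral_const_mul, integral_sub i1 i2, integral_sub i3 i4,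
      e1 hsh hshc, e1 hu huc]
    have e2 : ∫ x, fderiv ℝ (fun x => u (x + t • w)) x v * ψ x
        = ∫ x, ψ (x + t • (-w)) * fderiv ℝ u x v := by
      rw [← integral_add_right_eq_self (fun x => ψ (x + t • (-w)) * fderiv ℝ u x v) (t • w)]
      congr 1
      ext x
      rw [fderiv_comp_add_right]
      simp [mul_comm]
    rw [e2]
    simp only [mul_comm (ψ _)]
    ring
  simp only [ldu, ldψ, map_neg, neg_mul, integral_neg] at T1 T2
  simp only [key] at T1
  have := tendsto_nhds_unique T1 T2.neg
  simp only [neg_neg] at this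
  rw [← this]
  simp only [mul_comm]

lemma integral_cross {ψ u : ℂ → ℝ} {O : Set ℂ} (hO : IsOpen O) (hψ : ContDiff ℝ 1 ψ)
    (hψc : HasCompactSupport ψ) (hψO : tsupport ψ ⊆ O) (hu : ContDiffOn ℝ 1 u O) :
    ∫ z, (fderiv ℝ ψ z 1 * fderiv ℝ u z Complex.I - fderiv ℝ ψ z Complex.I * fderiv ℝ u z 1) = 0 := by
  obtain ⟨η, hη, hηc, hηO, hη1⟩ := exists_cutoff hψc hO hψO
  have hU : ContDiff ℝ 1 fun z => η z * u z := by
    refine contDiff_extend hO (isClosed_tsupport η) hηO (hη.contDiffOn.mul hu) ?_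
    intro x hx
    simp [image_eq_zero_of_notMem_tsupport hx]
  have hUc : HasCompactSupport fun z => η z * u z := hηc.mul_right
  have hd : ∀ z ∈ tsupport ψ, fderiv ℝ (fun z => η z * u z) z = fderiv ℝ u z := by
    intro z hz
    apply Filter.EventuallyEq.fderiv_eq
    filter_upwards [hη1.filter_mono (nhds_le_nhdsSet hz)] with y hy
    simp [hy]
  have h0 : ∀ z, z ∉ tsupport ψ → fderiv ℝ ψ z = 0 := fun z hz =>
    image_eq_zero_of_notMem_tsupport (fun h => hz (tsupport_fderiv_subset ℝ h))
  have e : ∀ z, (fderiv ℝ ψ z 1 * fderiv ℝ u z Complex.I - fderiv ℝ ψ z Complex.I * fderiv ℝ u z 1)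
     = fderiv ℝ ψ z 1 * fderiv ℝ (fun z => η z * u z) z Complex.I -
      fderiv ℝ ψ z Complex.I * fderiv ℝ (fun z => η z * u z) z 1 := by
    intro z
    by_cases hz : z ∈ tsupport ψ
    · rw [hd z hz]
    · simp [h0 z hz]
  have int : ∀ a b, Integrable fun z => fderiv ℝ ψ z a * fderiv ℝ (fun z => η z * u z) z b := by
    intro a b
    refine Continuous.integrable_of_hasCompactSupport ?_ (hψc.fderiv_apply ℝ a).mul_right
    exact ((hψ.continuous_fderiv (by simp)).clm_apply continuous_const).mul
      ((hU.continuous_fderiv (by simp)).clm_apply continuous_const)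
  simp only [e]
  rw [integral_sub (int _ _) (int _ _), integral_cross_aux hψ hψc hU hUc, sub_self]

/-- The squared positive part. -/
def pp (y : ℝ) : ℝ := (max y 0) ^ 2

lemma hasDerivAt_pp (y : ℝ) : HasDerivAt pp (2 * max y 0) y := by
  rcases lt_trichotomy y 0 with h | h | h
  · have : pp =ᶠ[𝓝 y] fun _ => 0 := by
      filter_upwards [Iio_mem_nhds h] with t ht
      simp [pp, max_eq_right (le_of_lt (mem_Iio.1 ht))]
    rw [max_eq_right h.le, mul_zero]
    exact (hasDerivAt_const y (0:ℝ)).congr_of_eventuallyEq this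
  · subst h
    rw [hasDerivAt_iff_isLittleO]
    simp only [pp, max_self, sub_zero, mul_zero, smul_zero]
    have : (fun t : ℝ => t ^ 2) =o[𝓝 0] fun t => t := by
      simpa using Asymptotics.isLittleO_pow_id (𝕜 := ℝ) one_lt_two
    refine Asymptotics.IsBigO.trans_isLittleO (Asymptotics.IsBigO.of_bound 1 ?_) this
    refine Eventually.of_forall fun t => ?_
    rw [one_mul, norm_pow]
    simp only [ne_eq, OfNat.ofNat_ne_zero, not_false_eq_true, zero_pow, sub_zero, norm_pow]
    have : ‖max t 0‖ ≤ ‖t‖ := by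
      rw [Real.norm_eq_abs, Real.norm_eq_abs, abs_of_nonneg (le_max_right t 0)]
      exact max_le (le_abs_self t) (abs_nonneg t)
    gcongr
  · have : pp =ᶠ[𝓝 y] fun t => t ^ 2 := by
      filter_upwards [Ioi_mem_nhds h] with t ht
      simp [pp, max_eq_left (le_of_lt (mem_Ioi.1 ht))]
    rw [max_eq_left h.le]
    simpa using (hasDerivAt_pow 2 y).congr_of_eventuallyEq this

lemma contDiff_pp : ContDiff ℝ 1 pp := by
  rw [contDiff_one_iff_deriv]
  refine ⟨fun y => (hasDerivAt_pp y).differentiableAt, ?_⟩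
  have : deriv pp = fun y => 2 * max y 0 := funext fun y => (hasDerivAt_pp y).deriv
  rw [this]
  fun_prop

/-- The Jacobian determinant of a planar map. -/
def jac (f : ℂ → ℂ) (z : ℂ) : ℝ :=
  (fderiv ℝ f z 1).re * (fderiv ℝ f z Complex.I).im -
    (fderiv ℝ f z 1).im * (fderiv ℝ f z Complex.I).re

end SH

namespace SH
open Filter

/-- Data for the core argument. -/
structure CoreData (f : ℂ → ℂ) (e : OpenPartialHomeomorph ℂ (ℝ × ℝ)) : Prop where
  he : ∀ z ∈ e.source, (e z).1 = (f z).re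
  hf : ContDiffOn ℝ 1 f e.source
  hd : ∀ z ∈ e.source, ∀ w, ‖fderiv ℝ f z w‖ ^ 2 ≤ 2 * jac f z * ‖w‖ ^ 2

namespace CoreData
variable {f : ℂ → ℂ} {e : OpenPartialHomeomorph ℂ (ℝ × ℝ)}

lemma hasFDerivAt (H : CoreData f e) {z : ℂ} (hz : z ∈ e.source) :
    HasFDerivAt f (fderiv ℝ f z) z :=
  ((H.hf.contDiffAt (e.open_source.mem_nhds hz)).differentiableAt (by simp)).hasFDerivAt

lemma jac_nonneg (H : CoreData f e) {z : ℂ} (hz : z ∈ e.source) : 0 ≤ jac f z := by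
  have := H.hd z hz 1
  simp at this
  have h2 := sq_nonneg ‖fderiv ℝ f z 1‖
  linarith

lemma fderiv_eq_zero (H : CoreData f e) {z : ℂ} (hz : z ∈ e.source) (h : jac f z = 0) :
    fderiv ℝ f z = 0 := by
  ext1 w
  have := H.hd z hz w
  rw [h] at this
  simp only [mul_zero, zero_mul] at this
  have h2 : ‖fderiv ℝ f z w‖ ^ 2 = 0 := le_antisymm this (sq_nonneg _)
  simpa using h2

lemma no_fold (H : CoreData f e) {a b₁ c b₂ : ℝ} (hb₁ : b₁ < c) (hb₂ : c < b₂)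
    (hbox : ∀ᶠ a' in 𝓝 a, ∀ b ∈ Icc b₁ b₂, (a', b) ∈ e.target) {s : ℝ} (hs : s ≠ 0)
    (h1 : s * (f (e.symm (a, b₁))).im < s * (f (e.symm (a, c))).im)
    (h2 : s * (f (e.symm (a, b₂))).im < s * (f (e.symm (a, c))).im) : False := by
  classical
  set V : ℝ × ℝ → ℝ := fun p => s * (f (e.symm p)).im with hV
  have hVc : ContinuousOn V e.target := by
    apply continuousOn_const.mul
    apply Complex.continuous_im.comp_continuousOn
    exact H.hf.continuousOn.comp e.symm.continuousOn (fun x hx => e.map_target hx)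
  obtain ⟨y, hy1, hy2⟩ : ∃ y, max (V (a, b₁)) (V (a, b₂)) < y ∧ y < V (a, c) :=
    exists_between (max_lt h1 h2)
  have hbT := hbox.self_of_nhds
  have ev : ∀ b ∈ Icc b₁ b₂, V (a, b) < y → ∀ᶠ a' in 𝓝 a, V (a', b) < y := by
    intro b hb hby
    have h3 : ContinuousAt (fun a' : ℝ => V (a', b)) a :=
      ContinuousAt.comp (g := V) (f := fun a' : ℝ => (a', b))
        (hVc.continuousAt (e.open_target.mem_nhds (hbT b hb))) (by fun_prop)
    exact h3.eventually_lt_const hby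
  have hall := (ev b₁ ⟨le_rfl, by linarith⟩ ((le_max_left _ _).trans_lt hy1)).and
    ((ev b₂ ⟨by linarith, le_rfl⟩ ((le_max_right _ _).trans_lt hy1)).and hbox)
  obtain ⟨δ', hδ', hball⟩ := Metric.eventually_nhds_iff_ball.1 hall
  set δ := δ' / 2 with hδ
  have hδ0 : 0 < δ := by positivity
  have hδδ : δ < δ' := by rw [hδ]; linarith
  -- the sets
  set B : Set (ℝ × ℝ) := Ioo (a - δ') (a + δ') ×ˢ Ioo b₁ b₂ with hB
  set Bc : Set (ℝ × ℝ) := Icc (a - δ) (a + δ) ×ˢ Icc b₁ b₂ with hBc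
  have hmem : ∀ a', |a' - a| < δ' → ∀ b ∈ Icc b₁ b₂, (a', b) ∈ e.target := by
    intro a' ha' b hb
    exact (hball a' (by rwa [Metric.mem_ball, Real.dist_eq])).2.2 b hb
  have hBT : B ⊆ e.target := by
    rintro ⟨a', b⟩ ⟨h3, h4⟩
    exact hmem a' (by rw [abs_lt]; constructor <;> linarith [h3.1, h3.2]) b (Ioo_subset_Icc_self h4)
  have hBcT : Bc ⊆ e.target := by
    rintro ⟨a', b⟩ ⟨h3, h4⟩
    exact hmem a' (by rw [abs_lt]; constructor <;> linarith [h3.1, h3.2]) b h4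
  set Kb : Set (ℝ × ℝ) := Bc ∩ V ⁻¹' (Ici y) with hKb
  have hBcc : IsCompact Bc := isCompact_Icc.prod isCompact_Icc
  have hKbc : IsCompact Kb := by
    apply hBcc.of_isClosed_subset _ inter_subset_left
    exact (hVc.mono hBcT).preimage_isClosed_of_isClosed hBcc.isClosed isClosed_Ici
  have hKbB : Kb ⊆ B := by
    rintro ⟨a', b⟩ ⟨⟨h3, h4⟩, h5⟩
    have ha' : |a' - a| < δ' := by rw [abs_lt]; constructor <;> linarith [h3.1, h3.2]
    have h6 := hball a' (by rwa [Metric.mem_ball, Real.dist_eq])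
    have h5' : y ≤ V (a', b) := h5
    refine ⟨by constructor <;> linarith [h3.1, h3.2], ?_, ?_⟩
    · refine lt_of_le_of_ne h4.1 ?_
      rintro rfl
      linarith [h6.1]
    · refine lt_of_le_of_ne h4.2 ?_
      rintro rfl
      linarith [h6.2.1]
  set D : Set ℂ := e.symm '' B with hDdef
  set K : Set ℂ := e.symm '' Kb with hKdef
  have hDo : IsOpen D := e.symm.isOpen_image_of_subset_source (isOpen_Ioo.prod isOpen_Ioo) hBT
  have hKc : IsCompact K := hKbc.image_of_continuousOn (e.symm.continuousOn.mono (hKbB.trans hBT))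
  have hKD : K ⊆ D := image_mono hKbB
  have hDs : D ⊆ e.source := by
    rintro _ ⟨p, hp, rfl⟩
    exact e.map_target (hBT hp)
  have hfD : ContDiffOn ℝ 1 f D := H.hf.mono hDs
  have hu : ContDiffOn ℝ 1 (fun z => (f z).re) D := Complex.reCLM.contDiff.comp_contDiffOn hfD
  have hv : ContDiffOn ℝ 1 (fun z => (f z).im) D := Complex.imCLM.contDiff.comp_contDiffOn hfD
  set g : ℂ → ℝ := fun z => pp (s * (f z).im - y) * pp (δ ^ 2 - ((f z).re - a) ^ 2) with hg
  have hgD : ContDiffOn ℝ 1 g D := by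
    apply ContDiffOn.mul
    · exact contDiff_pp.comp_contDiffOn ((contDiffOn_const.mul hv).sub contDiffOn_const)
    · exact contDiff_pp.comp_contDiffOn (contDiffOn_const.sub ((hu.sub contDiffOn_const).pow 2))
  set ψ : ℂ → ℝ := D.indicator g with hψdef
  have hψ0 : ∀ z, z ∉ K → ψ z = 0 := by
    intro z hz
    by_cases hzD : z ∈ D
    · rw [hψdef, indicator_of_mem hzD]
      obtain ⟨p, hp, rfl⟩ := hzD
      have hpT := hBT hp
      have hre : (f (e.symm p)).re = p.1 := by
        rw [← H.he _ (e.map_target hpT), e.right_inv hpT]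
      by_contra hne
      rw [hg] at hne
      simp only [pp, hre] at hne
      have n1 : 0 < s * (f (e.symm p)).im - y := by
        by_contra h; rw [not_lt] at h; simp [max_eq_right h] at hne
      have n2 : 0 < δ ^ 2 - (p.1 - a) ^ 2 := by
        by_contra h; rw [not_lt] at h; simp [max_eq_right h] at hne
      have n3 := abs_lt.1 (abs_lt_of_sq_lt_sq (by linarith : (p.1 - a) ^ 2 < δ ^ 2) hδ0.le)
      apply hz
      refine ⟨p, ⟨⟨⟨by linarith [n3.1], by linarith [n3.2]⟩, Ioo_subset_Icc_self hp.2⟩, ?_⟩, rfl⟩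
      show y ≤ s * (f (e.symm p)).im
      linarith
    · rw [hψdef, indicator_of_notMem hzD]
  have hψ : ContDiff ℝ 1 ψ := by
    apply contDiff_extend hDo hKc.isClosed hKD _ hψ0
    exact hgD.congr fun z hz => indicator_of_mem hz g
  have hψts : tsupport ψ ⊆ K := by
    apply closure_minimal _ hKc.isClosed
    intro x hx
    by_contra hxL
    exact hx (hψ0 x hxL)
  have hψc : HasCompactSupport ψ :=
    HasCompactSupport.of_support_subset_isCompact hKc ((subset_tsupport _).trans hψts)
  have I0 := integral_cross hDo hψ hψc (hψts.trans hKD) hu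
  -- computing the integrand
  set w : ℂ → ℝ := fun z => 2 * max (s * (f z).im - y) 0 * pp (δ ^ 2 - ((f z).re - a) ^ 2) with hw
  have hwn : ∀ z, 0 ≤ w z := fun z => by simp only [hw, pp]; positivity
  have comp : ∀ z ∈ D, fderiv ℝ ψ z 1 * fderiv ℝ (fun z => (f z).re) z Complex.I -
      fderiv ℝ ψ z Complex.I * fderiv ℝ (fun z => (f z).re) z 1 = - (s * (w z * jac f z)) := by
    intro z hz
    have hF := H.hasFDerivAt (hDs hz)
    have hre : HasFDerivAt (fun z => (f z).re) (Complex.reCLM.comp (fderiv ℝ f z)) z :=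
      Complex.reCLM.hasFDerivAt.comp z hF
    have him : HasFDerivAt (fun z => (f z).im) (Complex.imCLM.comp (fderiv ℝ f z)) z :=
      Complex.imCLM.hasFDerivAt.comp z hF
    have e1 : ψ =ᶠ[𝓝 z] g := by
      filter_upwards [hDo.mem_nhds hz] with x hx
      exact indicator_of_mem hx g
    have d1 := (hasDerivAt_pp (s * (f z).im - y)).comp_hasFDerivAt z ((him.const_mul s).sub_const y)
    have d2 := (hasDerivAt_pp (δ ^ 2 - ((f z).re - a) ^ 2)).comp_hasFDerivAt z
      (((hre.sub_const a).pow 2).const_sub (δ ^ 2))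
    have d3 := d1.mul d2
    have d4 := (d3.congr_of_eventuallyEq (e1.trans (Eventually.of_forall fun x => rfl))).fderiv
    rw [d4, hre.fderiv]
    simp only [hw, jac, Function.comp_apply]
    simp
    ring
  set Q : ℂ → ℝ := fun z => fderiv ℝ ψ z 1 * fderiv ℝ (fun z => (f z).re) z Complex.I -
      fderiv ℝ ψ z Complex.I * fderiv ℝ (fun z => (f z).re) z 1 with hQ
  have hQ0 : ∀ z, z ∉ K → Q z = 0 := by
    intro z hz
    have : fderiv ℝ ψ z = 0 :=
      image_eq_zero_of_notMem_tsupport (fun h => hz (hψts (tsupport_fderiv_subset ℝ h)))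
    simp [hQ, this]
  have hQc : Continuous Q := by
    rw [continuous_iff_continuousAt]
    intro z
    by_cases hz : z ∈ D
    · have c1 : ContinuousAt (fderiv ℝ (fun z => (f z).re)) z :=
        ((hu.contDiffAt (hDo.mem_nhds hz)).fderiv_right (m := 0) (by simp)).continuousAt
      have c2 : ContinuousAt (fderiv ℝ ψ) z := (hψ.continuous_fderiv (by simp)).continuousAt
      fun_prop
    · have : Q =ᶠ[𝓝 z] fun _ => 0 := by
        filter_upwards [hKc.isClosed.isOpen_compl.mem_nhds (fun h => hz (hKD h))] with x hx
        exact hQ0 x hx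
      exact continuousAt_const.congr this.symm
  have hQsupp : HasCompactSupport Q := HasCompactSupport.intro hKc hQ0
  have hsQn : ∀ z, 0 ≤ -s * Q z := by
    intro z
    by_cases hz : z ∈ D
    · have : Q z = _ := comp z hz
      rw [this]
      have := mul_nonneg (hwn z) (H.jac_nonneg (hDs hz))
      have := mul_nonneg (mul_self_nonneg s) this
      linarith
    · rw [hQ0 z (fun h => hz (hKD h))]; simp
  have hQz : ∀ z, Q z = 0 := by
    intro z
    by_contra hne
    have := Continuous.integral_pos_of_hasCompactSupport_nonneg_nonzero (μ := volume)
      (f := fun z => -s * Q z) (x := z) (by fun_prop) (hQsupp.mul_left) hsQn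
      (mul_ne_zero (neg_ne_zero.2 hs) hne)
    rw [integral_const_mul, I0, mul_zero] at this
    exact lt_irrefl _ this
  -- the open set where everything is critical
  have hca : (a, c) ∈ B := ⟨⟨by linarith, by linarith⟩, hb₁, hb₂⟩
  have hcrit : ∀ᶠ z in 𝓝 (e.symm (a, c)), z ∈ D ∧ fderiv ℝ f z = 0 := by
    have hp : e.symm (a, c) ∈ D := ⟨_, hca, rfl⟩
    have cf : ContinuousAt f (e.symm (a, c)) := hfD.continuousOn.continuousAt (hDo.mem_nhds hp)
    have ca : ContinuousAt (fun z => s * (f z).im) (e.symm (a, c)) := by fun_prop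
    have cb : ContinuousAt (fun z => δ ^ 2 - ((f z).re - a) ^ 2) (e.symm (a, c)) := by fun_prop
    have hre : (f (e.symm (a, c))).re = a := by
      rw [← H.he _ (e.map_target (hBT hca)), e.right_inv (hBT hca)]
    filter_upwards [hDo.mem_nhds hp, ca.eventually_const_lt hy2,
      cb.eventually_const_lt (u := 0) (by beta_reduce; rw [hre, sub_self]; simp; positivity)] with z hz h3 h4
    refine ⟨hz, H.fderiv_eq_zero (hDs hz) ?_⟩
    have h5 : Q z = _ := comp z hz
    rw [hQz z] at h5
    have h6 : w z * jac f z = 0 := by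
      have : s * (w z * jac f z) = 0 := by linarith
      exact (mul_eq_zero.1 this).resolve_left hs
    refine (mul_eq_zero.1 h6).resolve_left (ne_of_gt ?_)
    simp only [hw, pp]
    have : 0 < s * (f z).im - y := by linarith
    rw [max_eq_left this.le, max_eq_left h4.le]
    positivity
  obtain ⟨r, hr, hrb⟩ := Metric.eventually_nhds_iff_ball.1 hcrit
  have hconst : ∀ z ∈ Metric.ball (e.symm (a, c)) r, f z = f (e.symm (a, c)) := by
    intro z hz
    refine Metric.isOpen_ball.is_const_of_fderiv_eq_zero (𝕜 := ℝ)
      (convex_ball _ _).isPreconnected ?_ ?_ hz (Metric.mem_ball_self hr)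
    · intro x hx
      exact (H.hasFDerivAt (hDs (hrb x hx).1)).differentiableAt.differentiableWithinAt
    · intro x hx
      simpa using (hrb x hx).2
  have hcont : ContinuousAt (fun a' : ℝ => e.symm (a', c)) a :=
    ContinuousAt.comp (g := e.symm) (f := fun a' : ℝ => (a', c))
      (e.symm.continuousAt (hBT hca)) (by fun_prop)
  have h7 : ∀ᶠ a' in 𝓝 a, a' = a := by
    filter_upwards [hcont.eventually (Metric.ball_mem_nhds _ hr), hbox] with a' ha' hbb
    have h8 : (a', c) ∈ e.target := hbb c ⟨hb₁.le, hb₂.le⟩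
    have h9 := hconst _ ha'
    have e1 := H.he _ (e.map_target h8)
    have e2 := H.he _ (e.map_target (hBT hca))
    rw [e.right_inv h8] at e1
    rw [e.right_inv (hBT hca)] at e2
    simp only at e1 e2
    rw [e1, e2, h9]
  obtain ⟨r', hr', h10⟩ := Metric.eventually_nhds_iff_ball.1 h7
  have := h10 (a + r' / 2) (by
    rw [Metric.mem_ball, Real.dist_eq, add_sub_cancel_left, abs_of_pos (by positivity)]; linarith)
  linarith

end CoreData
end SH

namespace SH
open Filter
namespace CoreData
variable {f : ℂ → ℂ} {e : OpenPartialHomeomorph ℂ (ℝ × ℝ)}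

lemma seg_aux (H : CoreData f e) {a b₁ b₂ c : ℝ} (hb₁ : b₁ ≤ c) (hb₂ : c ≤ b₂)
    (hbox : ∀ᶠ a' in 𝓝 a, ∀ b ∈ Icc b₁ b₂, (a', b) ∈ e.target)
    (h : f (e.symm (a, b₁)) = f (e.symm (a, b₂))) :
    f (e.symm (a, c)) = f (e.symm (a, b₁)) := by
  rcases hb₁.eq_or_lt with rfl | hb₁
  · rfl
  rcases hb₂.eq_or_lt with rfl | hb₂
  · exact h.symm
  have hT := hbox.self_of_nhds
  have hre : ∀ b ∈ Icc b₁ b₂, (f (e.symm (a, b))).re = a := by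
    intro b hb
    rw [← H.he _ (e.map_target (hT b hb)), e.right_inv (hT b hb)]
  apply Complex.ext
  · rw [hre c ⟨hb₁.le, hb₂.le⟩, hre b₁ ⟨le_rfl, by linarith⟩]
  · rcases lt_trichotomy (f (e.symm (a, c))).im (f (e.symm (a, b₁))).im with h3 | h3 | h3
    · exact (H.no_fold (s := -1) hb₁ hb₂ hbox (by norm_num) (by linarith) (by rw [← h]; linarith)).elim
    · exact h3
    · exact (H.no_fold (s := 1) hb₁ hb₂ hbox (by norm_num) (by linarith) (by rw [← h]; linarith)).elim

/-- The fibres of `f` are segments. -/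
lemma seg (H : CoreData f e) {p : ℝ × ℝ} {δ : ℝ} (hp : Metric.ball p δ ⊆ e.target) {z₁ z₂ : ℂ}
    (h₁ : z₁ ∈ e.source) (h₁' : e z₁ ∈ Metric.ball p δ)
    (h₂ : z₂ ∈ e.source) (h₂' : e z₂ ∈ Metric.ball p δ) (h : f z₁ = f z₂)
    {t : ℝ} (ht : t ∈ Icc (0:ℝ) 1) :
    ((e z₁).1, (e z₁).2 + t * ((e z₂).2 - (e z₁).2)) ∈ e.target ∧
    f (e.symm ((e z₁).1, (e z₁).2 + t * ((e z₂).2 - (e z₁).2))) = f z₁ := by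
  set a := (e z₁).1 with ha
  set b₁ := (e z₁).2 with hb₁
  set b₂ := (e z₂).2 with hb₂
  have ha2 : (e z₂).1 = a := by rw [H.he _ h₂, ha, H.he _ h₁, h]
  have e1 : e z₁ = (a, b₁) := rfl
  have e2 : e z₂ = (a, b₂) := by rw [← ha2]
  have s1 : e.symm (a, b₁) = z₁ := by rw [← e1, e.left_inv h₁]
  have s2 : e.symm (a, b₂) = z₂ := by rw [← e2, e.left_inv h₂]
  rw [← ball_prod_same] at hp h₁' h₂'
  rw [e1] at h₁'
  rw [e2] at h₂'
  have hbox : ∀ᶠ a' in 𝓝 a, ∀ b ∈ uIcc b₁ b₂, (a', b) ∈ e.target := by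
    filter_upwards [Metric.isOpen_ball.mem_nhds h₁'.1] with a' ha' b hb
    refine hp ⟨ha', ?_⟩
    exact ((convex_ball p.2 δ).ordConnected.uIcc_subset h₁'.2 h₂'.2) hb
  have hc : b₁ + t * (b₂ - b₁) ∈ uIcc b₁ b₂ := by
    rcases le_total b₁ b₂ with h3 | h3
    · rw [uIcc_of_le h3]
      constructor <;> nlinarith [ht.1, ht.2]
    · rw [uIcc_of_ge h3]
      constructor <;> nlinarith [ht.1, ht.2]
  refine ⟨hbox.self_of_nhds _ hc, ?_⟩
  rcases le_total b₁ b₂ with h3 | h3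
  · rw [uIcc_of_le h3] at hbox hc
    rw [H.seg_aux hc.1 hc.2 hbox (by rw [s1, s2, h]), s1]
  · rw [uIcc_of_ge h3] at hbox hc
    rw [H.seg_aux hc.1 hc.2 hbox (by rw [s1, s2, h]), s2, h]

lemma inj (H : CoreData f e) {p : ℝ × ℝ} {δ : ℝ} (hp : Metric.ball p δ ⊆ e.target) {z₁ z₂ : ℂ}
    (h₁ : z₁ ∈ e.source) (h₁' : e z₁ ∈ Metric.ball p δ)
    (h₂ : z₂ ∈ e.source) (h₂' : e z₂ ∈ Metric.ball p δ) (h : f z₁ = f z₂)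
    (hj : jac f z₁ ≠ 0) : z₁ = z₂ := by
  by_contra hne
  have hinj : Function.Injective (fderiv ℝ f z₁) := by
    rw [injective_iff_map_eq_zero]
    intro w hw
    have e1 : w = w.re • (1:ℂ) + w.im • Complex.I := by
      apply Complex.ext <;> simp
    rw [e1, map_add, map_smul, map_smul] at hw
    have r := congrArg Complex.re hw
    have i := congrArg Complex.im hw
    simp at r i
    unfold jac at hj
    apply Complex.ext
    · apply (mul_eq_zero.1 _).resolve_right hj
      linear_combination (fderiv ℝ f z₁ Complex.I).im * r - (fderiv ℝ f z₁ Complex.I).re * i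
    · apply (mul_eq_zero.1 _).resolve_right hj
      linear_combination (fderiv ℝ f z₁ 1).re * i - (fderiv ℝ f z₁ 1).im * r
  have hanti : ∃ C, AntilipschitzWith C (fderiv ℝ f z₁) := by
    obtain ⟨C, -, hC⟩ := LinearMap.exists_antilipschitzWith (fderiv ℝ f z₁ : ℂ →ₗ[ℝ] ℂ)
      (LinearMap.ker_eq_bot.2 hinj)
    exact ⟨C, hC⟩
  have ev := (H.hasFDerivAt h₁).eventually_ne (c := f z₁) hanti
  rw [eventually_nhdsWithin_iff] at ev
  have hcont : ContinuousAt (fun t : ℝ =>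
      e.symm ((e z₁).1, (e z₁).2 + t * ((e z₂).2 - (e z₁).2))) 0 := by
    refine ContinuousAt.comp (g := e.symm)
      (f := fun t : ℝ => ((e z₁).1, (e z₁).2 + t * ((e z₂).2 - (e z₁).2))) ?_ (by fun_prop)
    apply e.symm.continuousAt
    simpa using e.map_source h₁
  have hv : e.symm ((e z₁).1, (e z₁).2 + 0 * ((e z₂).2 - (e z₁).2)) = z₁ := by
    simp [e.left_inv h₁]
  have ev2 : ∀ᶠ t in 𝓝[>] (0:ℝ), _ :=
    (hcont.eventually (p := fun z => z ∈ ({z₁} : Set ℂ)ᶜ → f z ≠ f z₁) (by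
      beta_reduce; rw [hv]; exact ev)).filter_mono nhdsWithin_le_nhds
  obtain ⟨t, ht1, ht2, ht3⟩ := (ev2.and
    (Filter.Eventually.and (self_mem_nhdsWithin : ∀ᶠ t in 𝓝[>] (0:ℝ), t ∈ Ioi (0:ℝ))
      (Filter.Eventually.filter_mono nhdsWithin_le_nhds
        (Iio_mem_nhds (zero_lt_one' ℝ) : ∀ᶠ t in 𝓝 (0:ℝ), t ∈ Iio (1:ℝ))))).exists
  have hs := H.seg hp h₁ h₁' h₂ h₂' h ⟨le_of_lt ht2, le_of_lt ht3⟩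
  refine ht1 ?_ hs.2
  intro heq
  have h5 : ((e z₁).1, (e z₁).2 + t * ((e z₂).2 - (e z₁).2)) = e z₁ := by
    rw [← e.right_inv hs.1, heq]
  have h6 := congrArg Prod.snd h5
  simp only [add_eq_left, mul_eq_zero] at h6
  rcases h6 with h6 | h6
  · exact absurd h6 (ne_of_gt ht2)
  · apply hne
    apply e.injOn h₁ h₂
    apply Prod.ext
    · rw [H.he _ h₁, H.he _ h₂, h]
    · linarith

end CoreData
end SH

namespace SH
open Filter

/-- Polar coordinates. -/
def pc (ρ θ : ℝ) : ℂ := ρ * (Real.cos θ + Real.sin θ * Complex.I)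

lemma norm_pc (ρ θ : ℝ) : ‖pc ρ θ‖ = |ρ| := by
  unfold pc
  rw [norm_mul, Complex.norm_real, Complex.ofReal_cos, Complex.ofReal_sin,
    Complex.norm_cos_add_sin_mul_I, mul_one, Real.norm_eq_abs]

lemma continuous_pc : Continuous (Function.uncurry pc) := by
  unfold pc Function.uncurry
  fun_prop

lemma pc_abs_arg (z : ℂ) : pc ‖z‖ z.arg = z := by
  unfold pc
  rw [Complex.ofReal_cos, Complex.ofReal_sin, Complex.norm_mul_cos_add_sin_mul_I]

lemma hasDerivAt_pc_left (ρ θ : ℝ) : HasDerivAt (fun ρ => pc ρ θ) (pc 1 θ) ρ := by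
  unfold pc
  simpa using ((Complex.ofRealCLM.hasDerivAt (x := ρ)).mul_const
    ((Real.cos θ : ℂ) + Real.sin θ * Complex.I))

lemma hasDerivAt_pc_right (ρ θ : ℝ) : HasDerivAt (fun θ => pc ρ θ) (Complex.I * pc ρ θ) θ := by
  unfold pc
  have h1 := (Real.hasDerivAt_cos θ).ofReal_comp
  have h2 := (Real.hasDerivAt_sin θ).ofReal_comp
  refine HasDerivAt.congr_deriv ((h1.add (h2.mul_const Complex.I)).const_mul (ρ : ℂ)) ?_
  push_cast
  linear_combination (-(ρ : ℂ) * Complex.sin θ) * Complex.I_mul_I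

lemma lintegral_polar {F : ℂ → ENNReal} (hF : Measurable F) :
    ∫⁻ z, F z = ∫⁻ ρ in Ioi (0:ℝ), ∫⁻ θ in Ioo (-Real.pi) Real.pi,
      ENNReal.ofReal ρ * F (pc ρ θ) := by
  rw [← Complex.lintegral_comp_polarCoord_symm, polarCoord_target, Measure.volume_eq_prod,
    ← Measure.prod_restrict, lintegral_prod]
  · simp only [Complex.polarCoord_symm_apply, pc, smul_eq_mul]
  · apply Measurable.aemeasurable
    simp only [Complex.polarCoord_symm_apply]
    refine Measurable.smul (f := fun p : ℝ × ℝ => ENNReal.ofReal p.1) (by fun_prop) (hF.comp ?_)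
    exact Continuous.measurable (by fun_prop)

lemma det_eq_jac (f : ℂ → ℂ) (z : ℂ) : (fderiv ℝ f z).det = jac f z := by
  rw [ContinuousLinearMap.det, ← LinearMap.det_toMatrix Complex.basisOneI, Matrix.det_fin_two]
  simp [LinearMap.toMatrix_apply, jac]
  ring

lemma integral_log_aux {M ε : ℝ} (hM : 0 ≤ M) (hε : 0 < ε) :
    ∫⁻ ρ in Ioc 0 M, ENNReal.ofReal (ρ / (ρ ^ 2 + ε ^ 2)) =
      ENNReal.ofReal (Real.log ((M ^ 2 + ε ^ 2) / ε ^ 2) / 2) := by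
  have hc : Continuous fun ρ : ℝ => ρ / (ρ ^ 2 + ε ^ 2) := by
    apply Continuous.div (by fun_prop) (by fun_prop)
    intro x; positivity
  have hd : ∀ x ∈ uIcc 0 M, HasDerivAt (fun ρ : ℝ => Real.log (ρ ^ 2 + ε ^ 2) / 2)
      (x / (x ^ 2 + ε ^ 2)) x := by
    intro x _
    have := ((((hasDerivAt_pow 2 x).add_const (ε ^ 2)).log (by positivity)).div_const 2)
    refine this.congr_deriv ?_
    push_cast
    field_simp
  have hI := intervalIntegral.integral_eq_sub_of_hasDerivAt hd (hc.intervalIntegrable _ _)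
  rw [intervalIntegral.integral_of_le hM] at hI
  rw [← ofReal_integral_eq_lintegral_ofReal, hI]
  · congr 1
    rw [Real.log_div (by positivity) (by positivity)]
    simp
    ring
  · exact (hc.intervalIntegrable 0 M).1
  · filter_upwards [self_mem_ae_restrict measurableSet_Ioc] with x hx
    have := hx.1
    simp only [Pi.zero_apply]
    positivity

lemma lintegral_ball_log {M ε : ℝ} (hM : 0 ≤ M) (hε : 0 < ε) :
    ∫⁻ w in Metric.closedBall (0:ℂ) M, ENNReal.ofReal (1 / (‖w‖ ^ 2 + ε ^ 2)) =
      ENNReal.ofReal (Real.pi * Real.log ((M ^ 2 + ε ^ 2) / ε ^ 2)) := by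
  have hm : Measurable fun w : ℂ => ENNReal.ofReal (1 / (‖w‖ ^ 2 + ε ^ 2)) := by
    fun_prop
  rw [← lintegral_indicator measurableSet_closedBall,
    lintegral_polar (hm.indicator measurableSet_closedBall)]
  have h1 : ∀ ρ ∈ Ioi (0:ℝ), ∫⁻ θ in Ioo (-Real.pi) Real.pi, ENNReal.ofReal ρ *
      (Metric.closedBall (0:ℂ) M).indicator
        (fun w : ℂ => ENNReal.ofReal (1 / (‖w‖ ^ 2 + ε ^ 2))) (pc ρ θ) =
      (Ioc 0 M).indicator (fun ρ => ENNReal.ofReal (ρ / (ρ ^ 2 + ε ^ 2))) ρ *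
        ENNReal.ofReal (2 * Real.pi) := by
    intro ρ hρ
    have hρ' : (0:ℝ) < ρ := hρ
    have : ∀ θ, ENNReal.ofReal ρ * (Metric.closedBall (0:ℂ) M).indicator
        (fun w : ℂ => ENNReal.ofReal (1 / (‖w‖ ^ 2 + ε ^ 2))) (pc ρ θ) =
      (Ioc 0 M).indicator (fun ρ => ENNReal.ofReal (ρ / (ρ ^ 2 + ε ^ 2))) ρ := by
      intro θ
      by_cases h : ρ ≤ M
      · rw [indicator_of_mem (show ρ ∈ Ioc 0 M from ⟨hρ, h⟩), indicator_of_mem, norm_pc, sq_abs,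
          ← ENNReal.ofReal_mul hρ'.le]
        · congr 1; ring
        · simpa [norm_pc, abs_of_pos hρ'] using h
      · rw [indicator_of_notMem (show ρ ∉ Ioc 0 M from fun h' => h h'.2), indicator_of_notMem,
          mul_zero]
        simpa [norm_pc, abs_of_pos hρ'] using h
    simp only [this]
    rw [setLIntegral_const, Real.volume_Ioo]
    congr 2
    ring
  rw [setLIntegral_congr_fun measurableSet_Ioi h1, lintegral_mul_const' _ _ ENNReal.ofReal_ne_top,
    setLIntegral_indicator measurableSet_Ioc,
    inter_eq_left.2 (fun x hx => hx.1), integral_log_aux hM hε,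
    ← ENNReal.ofReal_mul' (by positivity)]
  congr 1
  ring

/-- The weighted Jacobian. -/
def wj (f : ℂ → ℂ) (ε : ℝ) (z : ℂ) : ℝ := jac f z / (‖f z‖ ^ 2 + ε ^ 2)

namespace CoreData
variable {f : ℂ → ℂ} {e : OpenPartialHomeomorph ℂ (ℝ × ℝ)}

lemma continuousOn_jac (H : CoreData f e) : ContinuousOn (jac f) e.source := by
  have := H.hf.continuousOn_fderiv_of_isOpen e.open_source (by simp)
  unfold jac
  fun_prop

lemma continuousOn_wj (H : CoreData f e) {ε : ℝ} (hε : 0 < ε) :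
    ContinuousOn (wj f ε) e.source := by
  have h1 := H.continuousOn_jac
  have h2 := H.hf.continuousOn
  unfold wj
  apply h1.div (by fun_prop)
  intro x _
  positivity

lemma wj_nonneg (H : CoreData f e) {ε : ℝ} {z : ℂ} (hz : z ∈ e.source) : 0 ≤ wj f ε z :=
  div_nonneg (H.jac_nonneg hz) (by positivity)

lemma area (H : CoreData f e) {p : ℝ × ℝ} {δ : ℝ} (hp : Metric.ball p δ ⊆ e.target) {R M ε : ℝ}
    (hR : ∀ z ∈ Metric.ball (0:ℂ) R, z ∈ e.source ∧ e z ∈ Metric.ball p δ) (hM : 0 ≤ M)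
    (hfM : ∀ z ∈ Metric.ball (0:ℂ) R, ‖f z‖ ≤ M) (hε : 0 < ε) :
    ∫⁻ z in Metric.ball (0:ℂ) R, ENNReal.ofReal (wj f ε z) ≤
      ENNReal.ofReal (Real.pi * Real.log ((M ^ 2 + ε ^ 2) / ε ^ 2)) := by
  have hBs : Metric.ball (0:ℂ) R ⊆ e.source := fun z hz => (hR z hz).1
  set s : Set ℂ := Metric.ball (0:ℂ) R ∩ jac f ⁻¹' {0}ᶜ with hs
  have hso : IsOpen s :=
    (H.continuousOn_jac.mono hBs).isOpen_inter_preimage Metric.isOpen_ball isOpen_compl_singleton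
  have key := lintegral_image_eq_lintegral_abs_det_fderiv_mul (μ := volume) hso.measurableSet
    (f := f) (f' := fun z => fderiv ℝ f z)
    (fun z hz => (H.hasFDerivAt (hBs hz.1)).hasFDerivWithinAt)
    (fun z₁ h₁ z₂ h₂ h => H.inj hp (hR _ h₁.1).1 (hR _ h₁.1).2 (hR _ h₂.1).1 (hR _ h₂.1).2 h h₁.2)
    (fun w => ENNReal.ofReal (1 / (‖w‖ ^ 2 + ε ^ 2)))
  rw [← lintegral_ball_log hM hε]
  calc ∫⁻ z in Metric.ball (0:ℂ) R, ENNReal.ofReal (wj f ε z)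
      = ∫⁻ z in s, ENNReal.ofReal (wj f ε z) := by
        rw [← lintegral_indicator measurableSet_ball, ← lintegral_indicator hso.measurableSet]
        congr 1
        ext z
        by_cases hz : z ∈ Metric.ball (0:ℂ) R
        · by_cases hz2 : jac f z = 0
          · rw [indicator_of_mem hz, indicator_of_notMem (fun h => h.2 hz2)]
            simp [wj, hz2]
          · rw [indicator_of_mem hz, indicator_of_mem (show z ∈ s from ⟨hz, hz2⟩)]
        · rw [indicator_of_notMem hz, indicator_of_notMem (fun h => hz h.1)]
    _ = ∫⁻ z in s, ENNReal.ofReal |(fderiv ℝ f z).det| *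
          ENNReal.ofReal (1 / (‖f z‖ ^ 2 + ε ^ 2)) := by
        apply setLIntegral_congr_fun hso.measurableSet
        intro z hz
        beta_reduce
        rw [det_eq_jac, abs_of_nonneg (H.jac_nonneg (hBs hz.1)),
          ← ENNReal.ofReal_mul (H.jac_nonneg (hBs hz.1)), wj, mul_one_div]
    _ = ∫⁻ w in f '' s, ENNReal.ofReal (1 / (‖w‖ ^ 2 + ε ^ 2)) := key.symm
    _ ≤ _ := by
        apply lintegral_mono_set
        rintro _ ⟨z, hz, rfl⟩
        simpa using hfM z hz.1

/-- Area estimate in polar coordinates. -/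
lemma area_polar (H : CoreData f e) {p : ℝ × ℝ} {δ : ℝ} (hp : Metric.ball p δ ⊆ e.target)
    {R M ε : ℝ}
    (hR : ∀ z ∈ Metric.ball (0:ℂ) R, z ∈ e.source ∧ e z ∈ Metric.ball p δ) (hM : 0 ≤ M)
    (hfM : ∀ z ∈ Metric.ball (0:ℂ) R, ‖f z‖ ≤ M) (hε : 0 < ε) :
    ∫⁻ ρ in Ioo 0 R, ∫⁻ θ in Ioo (-Real.pi) Real.pi, ENNReal.ofReal (ρ * wj f ε (pc ρ θ)) ≤
      ENNReal.ofReal (Real.pi * Real.log ((M ^ 2 + ε ^ 2) / ε ^ 2)) ∧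
    ∫⁻ θ in Ioo (-Real.pi) Real.pi, ∫⁻ ρ in Ioo 0 R, ENNReal.ofReal (ρ * wj f ε (pc ρ θ)) ≤
      ENNReal.ofReal (Real.pi * Real.log ((M ^ 2 + ε ^ 2) / ε ^ 2)) := by
  have hBs : Metric.ball (0:ℂ) R ⊆ e.source := fun z hz => (hR z hz).1
  have hA := H.area hp hR hM hfM hε
  set F : ℂ → ENNReal := (Metric.ball (0:ℂ) R).indicator fun z => ENNReal.ofReal (wj f ε z) with hF
  have hFm : Measurable F := by
    classical
    have := (ENNReal.continuous_ofReal.comp_continuousOn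
      ((H.continuousOn_wj hε).mono hBs)).measurable_piecewise
      (continuousOn_const (c := (0:ENNReal)) (s := (Metric.ball (0:ℂ) R)ᶜ)) measurableSet_ball
    convert this using 1
    rw [hF]
    exact (piecewise_eq_indicator).symm
  rw [← lintegral_indicator measurableSet_ball, lintegral_polar hFm] at hA
  have hcomp : ∀ ρ θ, ρ ∈ Ioo 0 R → ENNReal.ofReal (ρ * wj f ε (pc ρ θ)) =
      ENNReal.ofReal ρ * F (pc ρ θ) := by
    intro ρ θ hρ
    rw [hF, indicator_of_mem, ENNReal.ofReal_mul hρ.1.le]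
    simpa [norm_pc, abs_of_pos hρ.1] using hρ.2
  have h1 : ∫⁻ ρ in Ioo 0 R, ∫⁻ θ in Ioo (-Real.pi) Real.pi, ENNReal.ofReal (ρ * wj f ε (pc ρ θ))
      = ∫⁻ ρ in Ioo 0 R, ∫⁻ θ in Ioo (-Real.pi) Real.pi, ENNReal.ofReal ρ * F (pc ρ θ) := by
    apply setLIntegral_congr_fun measurableSet_Ioo
    intro ρ hρ
    exact lintegral_congr fun θ => hcomp ρ θ hρ
  have h2 : ∫⁻ θ in Ioo (-Real.pi) Real.pi, ∫⁻ ρ in Ioo 0 R, ENNReal.ofReal (ρ * wj f ε (pc ρ θ))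
      = ∫⁻ θ in Ioo (-Real.pi) Real.pi, ∫⁻ ρ in Ioo 0 R, ENNReal.ofReal ρ * F (pc ρ θ) := by
    apply lintegral_congr
    intro θ
    apply setLIntegral_congr_fun measurableSet_Ioo
    intro ρ hρ
    exact hcomp ρ θ hρ
  have h3 : ∫⁻ ρ in Ioo 0 R, ∫⁻ θ in Ioo (-Real.pi) Real.pi, ENNReal.ofReal ρ * F (pc ρ θ) ≤
      ENNReal.ofReal (Real.pi * Real.log ((M ^ 2 + ε ^ 2) / ε ^ 2)) :=
    (lintegral_mono_set (fun x hx => hx.1)).trans hA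
  refine ⟨h1.trans_le h3, ?_⟩
  rw [h2, lintegral_lintegral_swap]
  · exact h3
  · apply Measurable.aemeasurable
    refine Measurable.mul (f := fun q : ℝ × ℝ => ENNReal.ofReal q.2)
      (g := fun q : ℝ × ℝ => F (pc q.2 q.1)) (by fun_prop) (hFm.comp ?_)
    exact (continuous_pc.comp continuous_swap).measurable

end CoreData
end SH

namespace SH
open Filter

/-- Regularized logarithm of the modulus. -/
def rl (ε : ℝ) (w : ℂ) : ℝ := Real.log (‖w‖ ^ 2 + ε ^ 2) / 2

lemma hasDerivAt_rl {ε : ℝ} (hε : 0 < ε) {w : ℝ → ℂ} {w' : ℂ} {t : ℝ} (h : HasDerivAt w w' t) :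
    HasDerivAt (fun t => rl ε (w t)) (inner ℝ (w t) w' / (‖w t‖ ^ 2 + ε ^ 2)) t := by
  have := (((h.norm_sq).add_const (ε ^ 2)).log (by positivity)).div_const 2
  refine this.congr_deriv ?_
  field_simp

lemma rl_deriv_sq {ε : ℝ} (hε : 0 < ε) (w w' : ℂ) :
    (inner ℝ w w' / (‖w‖ ^ 2 + ε ^ 2)) ^ 2 ≤ ‖w'‖ ^ 2 / (‖w‖ ^ 2 + ε ^ 2) := by
  have h1 : (inner ℝ w w') ^ 2 ≤ ‖w‖ ^ 2 * ‖w'‖ ^ 2 := by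
    rw [← mul_pow, ← sq_abs]
    gcongr
    exact abs_real_inner_le_norm w w'
  rw [div_pow, div_le_div_iff₀ (by positivity) (by positivity)]
  have h2 : 0 ≤ ‖w'‖ ^ 2 * ε ^ 2 * (‖w‖ ^ 2 + ε ^ 2) := by positivity
  have h3 : inner ℝ w w' ^ 2 * (‖w‖ ^ 2 + ε ^ 2) ≤ ‖w‖ ^ 2 * ‖w'‖ ^ 2 * (‖w‖ ^ 2 + ε ^ 2) := by
    gcongr
  nlinarith

namespace CoreData
variable {f : ℂ → ℂ} {e : OpenPartialHomeomorph ℂ (ℝ × ℝ)}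

lemma curve (H : CoreData f e) {ε : ℝ} (hε : 0 < ε) {a b : ℝ} (hab : a ≤ b) {γ γ' : ℝ → ℂ}
    (hγ : ∀ t ∈ Icc a b, HasDerivAt γ (γ' t) t) (hγ' : ContinuousOn γ' (Icc a b))
    (hs : ∀ t ∈ Icc a b, γ t ∈ e.source) {A c : ℝ → ℝ} (hA : ContinuousOn A (Icc a b))
    (hc : ContinuousOn c (Icc a b)) (hA0 : ∀ t ∈ Icc a b, 0 ≤ A t) (hc0 : ∀ t ∈ Icc a b, 0 ≤ c t)
    (hd : ∀ t ∈ Icc a b, ‖fderiv ℝ f (γ t) (γ' t)‖ ^ 2 ≤ A t * (c t * jac f (γ t))) :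
    ENNReal.ofReal (2 * |rl ε (f (γ b)) - rl ε (f (γ a))|) ≤ ENNReal.ofReal (∫ t in a..b, A t) +
      ∫⁻ t in Ioo a b, ENNReal.ofReal (c t * wj f ε (γ t)) := by
  set φ' : ℝ → ℝ := fun t => inner ℝ (f (γ t)) (fderiv ℝ f (γ t) (γ' t)) /
    (‖f (γ t)‖ ^ 2 + ε ^ 2) with hφ'
  set B : ℝ → ℝ := fun t => c t * wj f ε (γ t) with hB
  have hγc : ContinuousOn γ (Icc a b) := fun t ht => (hγ t ht).continuousAt.continuousWithinAt
  have hder : ∀ t ∈ uIcc a b, HasDerivAt (fun t => rl ε (f (γ t))) (φ' t) t := by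
    rw [uIcc_of_le hab]
    intro t ht
    exact hasDerivAt_rl hε ((H.hasFDerivAt (hs t ht)).comp_hasDerivAt t (hγ t ht))
  have hfγ : ContinuousOn (fun t => f (γ t)) (Icc a b) := H.hf.continuousOn.comp hγc hs
  have hfd : ContinuousOn (fun t => fderiv ℝ f (γ t)) (Icc a b) :=
    (H.hf.continuousOn_fderiv_of_isOpen e.open_source (by simp)).comp hγc hs
  have hφc : ContinuousOn φ' (Icc a b) := by
    apply ContinuousOn.div
    · exact hfγ.inner (𝕜 := ℝ) (hfd.clm_apply hγ')
    · exact (hfγ.norm.pow 2).add continuousOn_const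
    · intro t _; positivity
  have hBc : ContinuousOn B (Icc a b) := hc.mul ((H.continuousOn_wj hε).comp hγc hs)
  have hB0 : ∀ t ∈ Icc a b, 0 ≤ B t := fun t ht => mul_nonneg (hc0 t ht) (H.wj_nonneg (hs t ht))
  have hpt : ∀ t ∈ Icc a b, 2 * |φ' t| ≤ A t + B t := by
    intro t ht
    have h1 : φ' t ^ 2 ≤ A t * B t := by
      refine (rl_deriv_sq hε _ _).trans ?_
      rw [hB]
      simp only [wj]
      rw [← mul_div_assoc, ← mul_div_assoc]
      gcongr
      exact hd t ht
    have h2 : (2 * |φ' t|) ^ 2 ≤ (A t + B t) ^ 2 := by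
      rw [mul_pow, sq_abs]
      nlinarith [sq_nonneg (A t - B t)]
    exact (abs_le_of_sq_le_sq' h2 (add_nonneg (hA0 t ht) (hB0 t ht))).2
  have iφ : IntervalIntegrable φ' volume a b := by
    apply ContinuousOn.intervalIntegrable; rwa [uIcc_of_le hab]
  have iA : IntervalIntegrable A volume a b := by
    apply ContinuousOn.intervalIntegrable; rwa [uIcc_of_le hab]
  have iB : IntervalIntegrable B volume a b := by
    apply ContinuousOn.intervalIntegrable; rwa [uIcc_of_le hab]
  have hI := intervalIntegral.integral_eq_sub_of_hasDerivAt hder iφ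
  have hle : 2 * |rl ε (f (γ b)) - rl ε (f (γ a))| ≤ (∫ t in a..b, A t) + ∫ t in a..b, B t := by
    rw [← hI, ← intervalIntegral.integral_add iA iB]
    calc 2 * |∫ t in a..b, φ' t| ≤ 2 * ∫ t in a..b, |φ' t| := by
          gcongr
          exact intervalIntegral.abs_integral_le_integral_abs hab
      _ = ∫ t in a..b, 2 * |φ' t| := by rw [intervalIntegral.integral_const_mul]
      _ ≤ _ := intervalIntegral.integral_mono_on hab (iφ.abs.const_mul 2) (iA.add iB) hpt
  refine (ENNReal.ofReal_le_ofReal hle).trans (ENNReal.ofReal_add_le.trans ?_)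
  gcongr
  rw [intervalIntegral.integral_of_le hab, ofReal_integral_eq_lintegral_ofReal iB.1]
  · rw [setLIntegral_congr Ioo_ae_eq_Ioc]
  · filter_upwards [self_mem_ae_restrict measurableSet_Ioc] with x hx
    exact hB0 x (Ioc_subset_Icc_self hx)

/-- Circle estimate. -/
lemma circle_est (H : CoreData f e) {ε l ρ θ₀ θ₁ : ℝ} (hε : 0 < ε) (hl : 0 < l) (hρ : 0 < ρ)
    (hs : ∀ z : ℂ, ‖z‖ = ρ → z ∈ e.source)
    (h0 : θ₀ ∈ Icc (-Real.pi) Real.pi) (h1 : θ₁ ∈ Icc (-Real.pi) Real.pi) :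
    ENNReal.ofReal (2 * |rl ε (f (pc ρ θ₁)) - rl ε (f (pc ρ θ₀))|) ≤
      ENNReal.ofReal (4 * Real.pi * l) +
      ∫⁻ θ in Ioo (-Real.pi) Real.pi, ENNReal.ofReal (ρ ^ 2 / l * wj f ε (pc ρ θ)) := by
  wlog hle : θ₀ ≤ θ₁ generalizing θ₀ θ₁
  · rw [abs_sub_comm]
    exact this h1 h0 (le_of_not_ge hle)
  have hsrc : ∀ θ, pc ρ θ ∈ e.source := fun θ => hs _ (by rw [norm_pc, abs_of_pos hρ])
  have := H.curve hε hle (γ := fun θ => pc ρ θ) (γ' := fun θ => Complex.I * pc ρ θ)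
    (A := fun _ => 2 * l) (c := fun _ => ρ ^ 2 / l)
    (fun t _ => hasDerivAt_pc_right ρ t)
    (by
      apply Continuous.continuousOn
      exact continuous_const.mul (continuous_pc.comp (by fun_prop : Continuous fun θ : ℝ => (ρ, θ))))
    (fun t _ => hsrc t) continuousOn_const continuousOn_const (fun _ _ => by positivity)
    (fun _ _ => by positivity) (by
      intro t _
      refine (H.hd _ (hsrc t) _).trans (le_of_eq ?_)
      rw [norm_mul, Complex.norm_I, norm_pc, one_mul, sq_abs]
      field_simp)
  refine this.trans ?_
  gcongr
  · rw [intervalIntegral.integral_const, smul_eq_mul]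
    nlinarith [h0.1, h1.2, mul_le_mul_of_nonneg_right (show θ₁ - θ₀ ≤ 2 * Real.pi by linarith [h0.1, h1.2]) hl.le]
  · exact h0.1
  · exact h1.2

end CoreData
end SH

namespace SH
open Filter

namespace CoreData
variable {f : ℂ → ℂ} {e : OpenPartialHomeomorph ℂ (ℝ × ℝ)}

/-- `f` does not vanish identically on a circle. -/
lemma circle_ne (H : CoreData f e) {ρ : ℝ} (hρ : 0 < ρ)
    (hs : ∀ z : ℂ, ‖z‖ = ρ → z ∈ e.source) : ∃ z : ℂ, ‖z‖ = ρ ∧ f z ≠ 0 := by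
  by_contra! hcon
  have hn : ∀ θ, ‖pc ρ θ‖ = ρ := fun θ => by rw [norm_pc, abs_of_pos hρ]
  have hcont : Continuous fun θ => (e (pc ρ θ)).2 := by
    have h1 : Continuous fun θ => pc ρ θ :=
      continuous_pc.comp (by fun_prop : Continuous fun θ : ℝ => (ρ, θ))
    exact continuous_snd.comp (e.continuousOn.comp_continuous h1 fun θ => hs _ (hn θ))
  set h : ℝ → ℝ := fun θ => (e (pc ρ θ)).2 with hh
  have hper : h (0 + Real.pi + Real.pi) = h 0 := by
    have : pc ρ (0 + Real.pi + Real.pi) = pc ρ 0 := by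
      unfold pc
      rw [zero_add, Real.cos_add_pi, Real.sin_add_pi]
      simp
    simp only [hh, this]
  obtain ⟨θ, hθ⟩ : ∃ θ, h (θ + Real.pi) - h θ = 0 := by
    have hc : Continuous fun θ => h (θ + Real.pi) - h θ := by fun_prop
    have h2 : h (0 + Real.pi + Real.pi) - h (0 + Real.pi) = - (h (0 + Real.pi) - h 0) := by
      rw [hper]; ring
    rcases le_total (h (0 + Real.pi) - h 0) 0 with h3 | h3
    · exact mem_range_of_exists_le_of_exists_ge hc ⟨0, h3⟩ ⟨0 + Real.pi, by linarith⟩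
    · exact mem_range_of_exists_le_of_exists_ge hc ⟨0 + Real.pi, by linarith⟩ ⟨0, h3⟩
  have heq : pc ρ (θ + Real.pi) = pc ρ θ := by
    apply e.injOn (hs _ (hn _)) (hs _ (hn _))
    apply Prod.ext
    · rw [H.he _ (hs _ (hn _)), H.he _ (hs _ (hn _)), hcon _ (hn _), hcon _ (hn _)]
    · have : h (θ + Real.pi) = h θ := by linarith
      exact this
  have hneg : pc ρ (θ + Real.pi) = - pc ρ θ := by
    unfold pc
    rw [Real.cos_add_pi, Real.sin_add_pi]
    push_cast
    ring
  rw [hneg] at heq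
  have h0 : pc ρ θ = 0 := by
    have : (2:ℂ) * pc ρ θ = 0 := by linear_combination -heq
    simpa using this
  have := hn θ
  rw [h0, norm_zero] at this
  linarith

lemma light_aux {c M r R l : ℝ} (hc : 0 < c) (hM : 0 ≤ M) (hr : 0 < r) (hR : 0 < R) 
    (hl : l = 2 * Real.pi * R / r)
    (h : ∀ ε : ℝ, 0 < ε → ε ≤ 1 →
      (Real.log (c ^ 2 + ε ^ 2) - Real.log (ε ^ 2) - 4 * Real.pi * l) * (l / R) * r ≤
        Real.pi * Real.log ((M ^ 2 + ε ^ 2) / ε ^ 2)) : False := by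
  have hlr : l / R * r = 2 * Real.pi := by rw [hl]; field_simp
  have key : ∀ ε : ℝ, 0 < ε → ε ≤ 1 → - Real.log (ε ^ 2) ≤
      Real.log (M ^ 2 + 1) + 8 * Real.pi * l - 2 * Real.log (c ^ 2) := by
    intro ε h0 h1
    have h2 := h ε h0 h1
    rw [mul_assoc, hlr, Real.log_div (by positivity) (by positivity)] at h2
    have h3 : Real.log (M ^ 2 + ε ^ 2) ≤ Real.log (M ^ 2 + 1) := by
      apply Real.log_le_log (by positivity)
      nlinarith
    have h4 : Real.log (c ^ 2) ≤ Real.log (c ^ 2 + ε ^ 2) := by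
      apply Real.log_le_log (by positivity)
      nlinarith
    have h5 : 2 * (Real.log (c ^ 2 + ε ^ 2) - Real.log (ε ^ 2) - 4 * Real.pi * l) ≤
        Real.log (M ^ 2 + ε ^ 2) - Real.log (ε ^ 2) := by
      have := Real.pi_pos
      by_contra hcon
      rw [not_le] at hcon
      have := mul_lt_mul_of_pos_left hcon this
      linarith
    linarith
  set C := Real.log (M ^ 2 + 1) + 8 * Real.pi * l - 2 * Real.log (c ^ 2)
  have h6 := key (Real.exp (-(|C| + 1))) (Real.exp_pos _) (by
    rw [Real.exp_le_one_iff]; linarith [abs_nonneg C])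
  rw [Real.log_pow, Real.log_exp] at h6
  push_cast at h6
  linarith [abs_nonneg C, le_abs_self C]

/-- The zero at the origin is isolated. -/
lemma light (H : CoreData f e) {p : ℝ × ℝ} {δ : ℝ} (hp : Metric.ball p δ ⊆ e.target) {R M : ℝ}
    (hR : ∀ z ∈ Metric.ball (0:ℂ) R, z ∈ e.source ∧ e z ∈ Metric.ball p δ) (hM : 0 ≤ M)
    (hfM : ∀ z ∈ Metric.ball (0:ℂ) R, ‖f z‖ ≤ M) (hf0 : f 0 = 0)
    {q : ℂ} (hq : q ∈ Metric.ball (0:ℂ) R) (hfq : f q = 0) : q = 0 := by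
  by_contra hq0
  have hqn : 0 < ‖q‖ := norm_pos_iff.2 hq0
  have hqR : ‖q‖ < R := by simpa using hq
  have hR0 : 0 < R := hqn.trans hqR
  have h0R : (0:ℂ) ∈ Metric.ball (0:ℂ) R := by simpa using hR0
  -- zeros on each circle
  have hz : ∀ ρ ∈ Icc 0 ‖q‖, ∃ z : ℂ, ‖z‖ = ρ ∧ f z = 0 := by
    intro ρ hρ
    set γ : ℝ → ℂ := fun t => e.symm ((e 0).1, (e 0).2 + t * ((e q).2 - (e 0).2)) with hγ
    have hseg := fun t (ht : t ∈ Icc (0:ℝ) 1) => H.seg hp (hR 0 h0R).1 (hR 0 h0R).2 (hR q hq).1 (hR q hq).2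
      (by rw [hf0, hfq]) ht
    have hγc : ContinuousOn (fun t => ‖γ t‖) (Icc 0 1) := by
      apply ContinuousOn.norm
      refine e.symm.continuousOn.comp (by fun_prop) (fun t ht => (hseg t ht).1)
    have h1 : ‖γ 0‖ = 0 := by simp [hγ, e.left_inv (hR 0 h0R).1]
    have h2 : ‖γ 1‖ = ‖q‖ := by
      have : (e 0).1 = (e q).1 := by
        rw [H.he _ (hR 0 h0R).1, H.he _ (hR q hq).1, hf0, hfq]
      simp [hγ, this, e.left_inv (hR q hq).1]
    have := intermediate_value_Icc zero_le_one hγc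
    rw [h1, h2] at this
    obtain ⟨t, ht, htρ⟩ := this hρ
    exact ⟨γ t, htρ, by rw [(hseg t ht).2, hf0]⟩
  have hsrc : ∀ ρ ∈ Ioo 0 R, ∀ z : ℂ, ‖z‖ = ρ → z ∈ e.source := by
    intro ρ hρ z hz
    exact (hR z (by simpa [hz] using hρ.2)).1
  have hρs : ‖q‖ / 2 ∈ Ioo 0 R := ⟨by positivity, by linarith⟩
  obtain ⟨zs, hzs, hfzs⟩ := H.circle_ne hρs.1 (hsrc _ hρs)
  set θs := zs.arg with hθs
  set c := ‖f zs‖ / 2 with hcdef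
  have hc : 0 < c := by have := norm_pos_iff.2 hfzs; positivity
  have hcont : ContinuousAt (fun ρ => ‖f (pc ρ θs)‖) (‖q‖ / 2) := by
    apply ContinuousAt.norm
    refine ContinuousAt.comp (g := f) (f := fun ρ => pc ρ θs) ?_
      (continuous_pc.comp (by fun_prop : Continuous fun ρ : ℝ => (ρ, θs))).continuousAt
    rw [hθs, ← hzs, pc_abs_arg]
    exact (H.hasFDerivAt (hsrc _ hρs _ hzs)).continuousAt
  have hev : ∀ᶠ ρ in 𝓝 (‖q‖ / 2), c < ‖f (pc ρ θs)‖ := by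
    apply hcont.eventually_const_lt
    beta_reduce
    rw [hθs, ← hzs, pc_abs_arg]
    linarith
  obtain ⟨r', hr', hball⟩ := Metric.eventually_nhds_iff_ball.1 hev
  set r := min r' (‖q‖ / 2) with hr
  have hr0 : 0 < r := lt_min hr' (by positivity)
  have hrq : r ≤ ‖q‖ / 2 := min_le_right _ _
  have hrr' : r ≤ r' := min_le_left _ _
  refine light_aux (l := 2 * Real.pi * R / r) hc hM hr0 hR0 rfl ?_
  set l := 2 * Real.pi * R / r with hl
  have hl0 : 0 < l := by have := Real.pi_pos; positivity
  intro ε hε hε1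
  have hA := (H.area_polar hp hR hM hfM hε).1
  set Λ := Real.log (c ^ 2 + ε ^ 2) - Real.log (ε ^ 2) with hΛ
  rcases le_or_gt (Λ - 4 * Real.pi * l) 0 with hneg | hpos
  · have h1 : 0 ≤ Real.log ((M ^ 2 + ε ^ 2) / ε ^ 2) := by
      apply Real.log_nonneg
      rw [le_div_iff₀ (by positivity)]
      nlinarith
    have h2 := mul_nonneg Real.pi_pos.le h1
    have h3 : 0 ≤ l / R * r := by positivity
    have := mul_nonpos_of_nonpos_of_nonneg hneg h3
    rw [mul_assoc]
    linarith
  have hρ : ∀ ρ ∈ Ioo (‖q‖ / 2 - r) (‖q‖ / 2),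
      ENNReal.ofReal ((Λ - 4 * Real.pi * l) * (l / R)) ≤
        ∫⁻ θ in Ioo (-Real.pi) Real.pi, ENNReal.ofReal (ρ * wj f ε (pc ρ θ)) := by
    intro ρ hρ
    have hρ0 : 0 < ρ := by linarith [hρ.1]
    have hρR : ρ < R := by linarith [hρ.2]
    obtain ⟨z0, hz0, hfz0⟩ := hz ρ ⟨hρ0.le, by linarith [hρ.2]⟩
    have hce := H.circle_est hε hl0 hρ0 (hsrc ρ ⟨hρ0, hρR⟩)
      (θ₀ := z0.arg) (θ₁ := θs) (Ioc_subset_Icc_self (Complex.arg_mem_Ioc z0))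
      (Ioc_subset_Icc_self (Complex.arg_mem_Ioc zs))
    have hz0' : pc ρ z0.arg = z0 := by rw [← hz0, pc_abs_arg]
    rw [hz0', hfz0] at hce
    have hbig : c < ‖f (pc ρ θs)‖ := hball ρ (by
      rw [Metric.mem_ball, Real.dist_eq, abs_lt]; constructor <;> linarith [hρ.1, hρ.2])
    have h1 : Λ ≤ 2 * |rl ε (f (pc ρ θs)) - rl ε 0| := by
      have : Real.log (c ^ 2 + ε ^ 2) ≤ Real.log (‖f (pc ρ θs)‖ ^ 2 + ε ^ 2) := by
        apply Real.log_le_log (by positivity)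
        gcongr
      have h2 := le_abs_self (rl ε (f (pc ρ θs)) - rl ε 0)
      have h3 : 2 * (rl ε (f (pc ρ θs)) - rl ε 0) =
          Real.log (‖f (pc ρ θs)‖ ^ 2 + ε ^ 2) - Real.log (ε ^ 2) := by
        simp [rl]; ring
      linarith
    have h2 : ENNReal.ofReal (Λ - 4 * Real.pi * l) ≤
        ∫⁻ θ in Ioo (-Real.pi) Real.pi, ENNReal.ofReal (ρ ^ 2 / l * wj f ε (pc ρ θ)) := by
      rw [ENNReal.ofReal_sub _ (by positivity), tsub_le_iff_left]
      exact (ENNReal.ofReal_le_ofReal h1).trans hce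
    have h3 : ∀ θ, ENNReal.ofReal (ρ ^ 2 / l * wj f ε (pc ρ θ)) =
        ENNReal.ofReal (ρ / l) * ENNReal.ofReal (ρ * wj f ε (pc ρ θ)) := by
      intro θ
      rw [← ENNReal.ofReal_mul (by positivity)]
      congr 1
      ring
    simp only [h3] at h2
    rw [lintegral_const_mul' _ _ ENNReal.ofReal_ne_top] at h2
    calc ENNReal.ofReal ((Λ - 4 * Real.pi * l) * (l / R))
        ≤ ENNReal.ofReal ((l / ρ) * (Λ - 4 * Real.pi * l)) := by
          apply ENNReal.ofReal_le_ofReal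
          rw [mul_comm]
          gcongr
      _ = ENNReal.ofReal (l / ρ) * ENNReal.ofReal (Λ - 4 * Real.pi * l) :=
          ENNReal.ofReal_mul (by positivity)
      _ ≤ ENNReal.ofReal (l / ρ) * (ENNReal.ofReal (ρ / l) * 
          ∫⁻ θ in Ioo (-Real.pi) Real.pi, ENNReal.ofReal (ρ * wj f ε (pc ρ θ))) := by
          gcongr
      _ = _ := by
          rw [← mul_assoc, ← ENNReal.ofReal_mul (by positivity)]
          have : l / ρ * (ρ / l) = 1 := by field_simp
          rw [this, ENNReal.ofReal_one, one_mul]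
  have hfin : ENNReal.ofReal ((Λ - 4 * Real.pi * l) * (l / R) * r) ≤
      ENNReal.ofReal (Real.pi * Real.log ((M ^ 2 + ε ^ 2) / ε ^ 2)) := by
    refine le_trans ?_ hA
    calc ENNReal.ofReal ((Λ - 4 * Real.pi * l) * (l / R) * r)
        = ∫⁻ ρ in Ioo (‖q‖ / 2 - r) (‖q‖ / 2), ENNReal.ofReal ((Λ - 4 * Real.pi * l) * (l / R)) := by
          rw [setLIntegral_const, Real.volume_Ioo, ENNReal.ofReal_mul (by positivity)]
          congr 2
          ring
      _ ≤ ∫⁻ ρ in Ioo (‖q‖ / 2 - r) (‖q‖ / 2),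
            ∫⁻ θ in Ioo (-Real.pi) Real.pi, ENNReal.ofReal (ρ * wj f ε (pc ρ θ)) :=
          setLIntegral_mono' measurableSet_Ioo hρ
      _ ≤ _ := by
          apply lintegral_mono_set
          intro x hx
          exact ⟨by linarith [hx.1], by linarith [hx.2]⟩
  rw [ENNReal.ofReal_le_ofReal_iff'] at hfin
  rcases hfin with h | h
  · exact h
  · exfalso
    have : 0 < (Λ - 4 * Real.pi * l) * (l / R) * r := by positivity
    linarith

end CoreData
end SH

namespace SH
open Filter

lemma integral_A_le {C α r R : ℝ} (hα : 0 < α) (hC : 0 ≤ C) (hr : 0 < r) (hrR : r ≤ R) :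
    ∫ ρ in r..R, (1 + C * ρ ^ α) / ρ ≤ Real.log R - Real.log r + C / α * R ^ α := by
  have hR : 0 < R := hr.trans_le hrR
  have h0 : ∀ x ∈ uIcc r R, 0 < x := by
    intro x hx
    rw [uIcc_of_le hrR] at hx
    linarith [hx.1]
  have hd : ∀ x ∈ uIcc r R, HasDerivAt (fun ρ : ℝ => Real.log ρ + C / α * ρ ^ α)
      ((1 + C * x ^ α) / x) x := by
    intro x hx
    have hx0 := h0 x hx
    have h1 := (Real.hasDerivAt_log hx0.ne').add
      (((Real.hasDerivAt_rpow_const (p := α) (Or.inl hx0.ne'))).const_mul (C / α))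
    refine h1.congr_deriv ?_
    rw [Real.rpow_sub_one hx0.ne']
    field_simp
  have hc : ContinuousOn (fun ρ : ℝ => (1 + C * ρ ^ α) / ρ) (uIcc r R) := by
    apply ContinuousOn.div _ continuousOn_id (fun x hx => (h0 x hx).ne')
    refine continuousOn_const.add (continuousOn_const.mul ?_)
    exact continuousOn_id.rpow_const (fun x hx => Or.inr hα.le)
  rw [intervalIntegral.integral_eq_sub_of_hasDerivAt hd hc.intervalIntegrable]
  have : 0 ≤ C / α * r ^ α := by positivity
  linarith

namespace CoreData
variable {f : ℂ → ℂ} {e : OpenPartialHomeomorph ℂ (ℝ × ℝ)}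

theorem core_false (H : CoreData f e) (h0 : (0:ℂ) ∈ e.source) (hf0 : f 0 = 0)
    (hdf0 : fderiv ℝ f 0 = 0) {C α : ℝ} (hα : 0 < α) (hC : 0 ≤ C)
    (hfine : ∀ z ∈ e.source, ∀ w, ‖fderiv ℝ f z w‖ ^ 2 ≤ (1 + C * ‖z‖ ^ α) * jac f z * ‖w‖ ^ 2) :
    False := by
  obtain ⟨δ, hδ, hp⟩ := Metric.isOpen_iff.1 e.open_target (e 0) (e.map_source h0)
  have hev : ∀ᶠ z in 𝓝 (0:ℂ), (z ∈ e.source ∧ e z ∈ Metric.ball (e 0) δ) ∧ ‖f z‖ < 1 := by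
    have hes : ∀ᶠ z in 𝓝 (0:ℂ), z ∈ e.source := e.open_source.mem_nhds h0
    refine (hes.and
      ((e.continuousAt h0).eventually (Metric.ball_mem_nhds _ hδ))).and ?_
    apply (H.hasFDerivAt h0).continuousAt.norm.eventually_lt_const
    beta_reduce
    rw [hf0, norm_zero]
    norm_num
  obtain ⟨R, hR0, hball⟩ := Metric.eventually_nhds_iff_ball.1 hev
  have hR : ∀ z ∈ Metric.ball (0:ℂ) R, z ∈ e.source ∧ e z ∈ Metric.ball (e 0) δ :=
    fun z hz => (hball z hz).1
  have hfM : ∀ z ∈ Metric.ball (0:ℂ) R, ‖f z‖ ≤ 1 := fun z hz => (hball z hz).2.le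
  set R₀ := R / 2 with hR₀
  have hR₀0 : 0 < R₀ := by positivity
  have hR₀R : R₀ < R := by rw [hR₀]; linarith
  -- lower bound on the sphere
  obtain ⟨c, hc, hcs⟩ : ∃ c > 0, ∀ θ, c ≤ ‖f (pc R₀ θ)‖ := by
    have hsub : Metric.sphere (0:ℂ) R₀ ⊆ Metric.ball (0:ℂ) R := by
      intro z hz
      simp only [mem_sphere_iff_norm, sub_zero] at hz
      simpa [hz] using hR₀R
    have hcont : ContinuousOn (fun z => ‖f z‖) (Metric.sphere (0:ℂ) R₀) :=
      (H.hf.continuousOn.mono fun z hz => (hR z (hsub hz)).1).norm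
    have hne : (Metric.sphere (0:ℂ) R₀).Nonempty := ⟨pc R₀ 0, by simp [norm_pc, abs_of_pos hR₀0]⟩
    obtain ⟨z, hz, hmin⟩ := (isCompact_sphere (0:ℂ) R₀).exists_isMinOn hne hcont
    refine ⟨‖f z‖, ?_, fun θ => hmin (by simp [norm_pc, abs_of_pos hR₀0])⟩
    apply norm_pos_iff.2
    intro hfz
    have := H.light hp hR zero_le_one hfM hf0 (hsub hz) hfz
    rw [this] at hz
    simp at hz
    linarith
  set K₀ := 3 * Real.log 2 + 2 * Real.log R₀ + 2 * (C / α * R₀ ^ α) - 2 * Real.log (c ^ 2) with hK₀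
  set η := Real.exp (-(|K₀| + 1)) with hη
  have hη0 : 0 < η := Real.exp_pos _
  have hη1 : η ≤ 1 := by rw [hη, Real.exp_le_one_iff]; linarith [abs_nonneg K₀]
  have hsmall : ∀ᶠ z in 𝓝 (0:ℂ), ‖f z‖ ≤ η * ‖z‖ := by
    have h1 := (hasFDerivAt_iff_isLittleO_nhds_zero.1 (H.hasFDerivAt h0)).def hη0
    simpa [hf0, hdf0] using h1
  obtain ⟨r₀, hr₀, hb⟩ := Metric.eventually_nhds_iff_ball.1 hsmall
  set r := min (r₀ / 2) (min R₀ 1) with hr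
  have hr0 : 0 < r := lt_min (by positivity) (lt_min hR₀0 one_pos)
  have hrr₀ : r < r₀ := (min_le_left _ _).trans_lt (by linarith)
  have hrR₀ : r ≤ R₀ := (min_le_right _ _).trans (min_le_left _ _)
  have hr1 : r ≤ 1 := (min_le_right _ _).trans (min_le_right _ _)
  set ε := η * r with hε
  have hε0 : 0 < ε := by positivity
  have hε1 : ε ≤ 1 := by rw [hε]; nlinarith
  have hfr : ∀ θ, ‖f (pc r θ)‖ ≤ ε := by
    intro θ
    have := hb (pc r θ) (by simpa [norm_pc, abs_of_pos hr0] using hrr₀)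
    rwa [norm_pc, abs_of_pos hr0] at this
  have hA := (H.area_polar hp hR zero_le_one hfM hε0).2
  set L := Real.log R₀ - Real.log r + C / α * R₀ ^ α with hL
  set Λ := Real.log (c ^ 2 + ε ^ 2) - Real.log (2 * ε ^ 2) with hΛ
  have hθ : ∀ θ, ENNReal.ofReal (Λ - L) ≤ ∫⁻ ρ in Ioo 0 R, ENNReal.ofReal (ρ * wj f ε (pc ρ θ)) := by
    intro θ
    have hpos : ∀ t ∈ Icc r R₀, 0 < t := fun t ht => hr0.trans_le ht.1
    have hsrc : ∀ t ∈ Icc r R₀, pc t θ ∈ e.source := by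
      intro t ht
      refine (hR _ ?_).1
      have := ht.2
      simp only [Metric.mem_ball, dist_zero_right, norm_pc, abs_of_pos (hpos t ht)]
      linarith
    have hcv := H.curve hε0 hrR₀ (γ := fun ρ => pc ρ θ) (γ' := fun _ => pc 1 θ)
      (A := fun ρ => (1 + C * ρ ^ α) / ρ) (c := fun ρ => ρ)
      (fun t _ => hasDerivAt_pc_left t θ) continuousOn_const hsrc
      (by
        apply ContinuousOn.div _ continuousOn_id (fun x hx => (hpos x hx).ne')
        refine continuousOn_const.add (continuousOn_const.mul ?_)
        exact continuousOn_id.rpow_const (fun x hx => Or.inr hα.le))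
      continuousOn_id (fun t ht => by have := hpos t ht; positivity)
      (fun t ht => (hpos t ht).le) (by
        intro t ht
        have ht0 := hpos t ht
        refine (hfine _ (hsrc t ht) _).trans (le_of_eq ?_)
        rw [norm_pc, norm_pc, abs_of_pos ht0]
        simp only [abs_one]
        field_simp)
    have h1 : Λ ≤ 2 * |rl ε (f (pc R₀ θ)) - rl ε (f (pc r θ))| := by
      have a1 : Real.log (c ^ 2 + ε ^ 2) ≤ Real.log (‖f (pc R₀ θ)‖ ^ 2 + ε ^ 2) := by
        apply Real.log_le_log (by positivity)
        have := hcs θ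
        gcongr
      have a2 : Real.log (‖f (pc r θ)‖ ^ 2 + ε ^ 2) ≤ Real.log (2 * ε ^ 2) := by
        apply Real.log_le_log (by positivity)
        have : ‖f (pc r θ)‖ ^ 2 ≤ ε ^ 2 := by
          have := hfr θ
          gcongr
        linarith
      have h2 := le_abs_self (rl ε (f (pc R₀ θ)) - rl ε (f (pc r θ)))
      have h3 : 2 * (rl ε (f (pc R₀ θ)) - rl ε (f (pc r θ))) =
          Real.log (‖f (pc R₀ θ)‖ ^ 2 + ε ^ 2) - Real.log (‖f (pc r θ)‖ ^ 2 + ε ^ 2) := by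
        simp [rl]; ring
      linarith
    have hI0 : 0 ≤ ∫ ρ in r..R₀, (1 + C * ρ ^ α) / ρ := by
      apply intervalIntegral.integral_nonneg hrR₀
      intro t ht
      have := hpos t ht
      positivity
    have hI := integral_A_le hα hC hr0 hrR₀
    calc ENNReal.ofReal (Λ - L) ≤ ENNReal.ofReal (Λ - ∫ ρ in r..R₀, (1 + C * ρ ^ α) / ρ) := by
          apply ENNReal.ofReal_le_ofReal; linarith
      _ ≤ ∫⁻ ρ in Ioo r R₀, ENNReal.ofReal (ρ * wj f ε (pc ρ θ)) := by
          rw [ENNReal.ofReal_sub _ hI0, tsub_le_iff_left]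
          exact (ENNReal.ofReal_le_ofReal h1).trans hcv
      _ ≤ _ := by
          apply lintegral_mono_set
          intro x hx
          exact ⟨by linarith [hx.1], by linarith [hx.2]⟩
  have hfin : ENNReal.ofReal ((Λ - L) * (2 * Real.pi)) ≤
      ENNReal.ofReal (Real.pi * Real.log ((1 ^ 2 + ε ^ 2) / ε ^ 2)) := by
    refine le_trans ?_ hA
    calc ENNReal.ofReal ((Λ - L) * (2 * Real.pi))
        = ∫⁻ θ in Ioo (-Real.pi) Real.pi, ENNReal.ofReal (Λ - L) := by
          rw [setLIntegral_const, Real.volume_Ioo,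
            ENNReal.ofReal_mul' (by have := Real.pi_pos; positivity)]
          congr 2
          ring
      _ ≤ _ := setLIntegral_mono' measurableSet_Ioo (fun θ _ => hθ θ)
  have hlog : 0 ≤ Real.log ((1 ^ 2 + ε ^ 2) / ε ^ 2) := by
    apply Real.log_nonneg
    rw [le_div_iff₀ (by positivity)]
    nlinarith
  have hfin2 : (Λ - L) * (2 * Real.pi) ≤ Real.pi * Real.log ((1 ^ 2 + ε ^ 2) / ε ^ 2) := by
    rw [ENNReal.ofReal_le_ofReal_iff (mul_nonneg Real.pi_pos.le hlog)] at hfin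
    exact hfin
  have hfin3 : 2 * (Λ - L) ≤ Real.log ((1 ^ 2 + ε ^ 2) / ε ^ 2) := by
    by_contra hcon
    rw [not_le] at hcon
    have := mul_lt_mul_of_pos_left hcon Real.pi_pos
    linarith
  rw [Real.log_div (by positivity) (by positivity)] at hfin3
  have b1 : Real.log (1 ^ 2 + ε ^ 2) ≤ Real.log 2 := by
    apply Real.log_le_log (by positivity)
    nlinarith
  have b2 : Real.log (c ^ 2) ≤ Real.log (c ^ 2 + ε ^ 2) := by
    apply Real.log_le_log (by positivity)
    nlinarith
  have b3 : Real.log (2 * ε ^ 2) = Real.log 2 + Real.log (ε ^ 2) :=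
    Real.log_mul (by norm_num) (by positivity)
  have b4 : Real.log (ε ^ 2) = 2 * (-(|K₀| + 1) + Real.log r) := by
    rw [Real.log_pow, hε, Real.log_mul hη0.ne' hr0.ne', hη, Real.log_exp]
    push_cast
    ring
  have b5 := le_abs_self K₀
  have b6 := abs_nonneg K₀
  rw [hΛ, hL, b3] at hfin3
  rw [b4] at hfin3
  have hK₁ : K₀ = 3 * Real.log 2 + 2 * Real.log R₀ + 2 * (C / α * R₀ ^ α) - 2 * Real.log (c ^ 2) :=
    hK₀
  generalize C / α * R₀ ^ α = X at hK₁ hfin3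
  clear_value K₀
  clear hA hfin hfin2 hK₀ hL hΛ b3 b4 hlog
  have h9 : 2 * |K₀| + 2 ≤ K₀ := by rw [hK₁] at *; linarith
  linarith

end CoreData
end SH


namespace SH
open Filter

/-- Mollification. -/
def moll (η g : E2 → ℝ) : E2 → ℝ :=
  convolution η g (ContinuousLinearMap.lsmul ℝ ℝ) volume

lemma hasFDerivAt_moll {η g : E2 → ℝ} (hη : ContDiff ℝ (⊤ : ℕ∞) η) (hηc : HasCompactSupport η)
    (hg : LocallyIntegrable g volume) (x : E2) : ∃ D : E2 →L[ℝ] ℝ, HasFDerivAt (moll η g) D x ∧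
      ∀ u, Integrable (fun t => fderiv ℝ η t u * g (x - t)) ∧
        D u = ∫ t, fderiv ℝ η t u * g (x - t) := by
  have hη1 : ContDiff ℝ 1 η := hη.of_le (by exact_mod_cast le_top)
  refine ⟨_, HasCompactSupport.hasFDerivAt_convolution_left (ContinuousLinearMap.lsmul ℝ ℝ)
    hηc hη1 hg x, ?_⟩
  intro u
  have hex := HasCompactSupport.convolutionExists_left
    (ContinuousLinearMap.precompL E2 (ContinuousLinearMap.lsmul ℝ ℝ)) (hηc.fderiv ℝ)
    (hη1.continuous_fderiv (by simp)) hg x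
  have hex' : Integrable (fun t => (ContinuousLinearMap.precompL E2 (ContinuousLinearMap.lsmul ℝ ℝ))
    (fderiv ℝ η t) (g (x - t))) := hex
  refine ⟨?_, ?_⟩
  · have := hex'.apply_continuousLinearMap u
    simpa using this
  · rw [convolution_def, ContinuousLinearMap.integral_apply hex']
    simp

lemma contDiff_moll {η g : E2 → ℝ} (hη : ContDiff ℝ (⊤ : ℕ∞) η) (hηc : HasCompactSupport η)
    (hg : LocallyIntegrable g volume) : ContDiff ℝ 1 (moll η g) :=
  HasCompactSupport.contDiff_convolution_left (ContinuousLinearMap.lsmul ℝ ℝ)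
    hηc (hη.of_le (by exact_mod_cast le_top)) hg

lemma moll_div {Ω : Set E2} (hΩ : IsOpen Ω) {P Q : E2 → ℝ}
    (h : ∀ φ, IsTestOn Ω φ →
      ∫ x in Ω, (P x * fderiv ℝ φ x (e2 0) + Q x * fderiv ℝ φ x (e2 1)) = 0)
    {B : Set E2} (hB : B ⊆ Ω) (hP : LocallyIntegrable (B.indicator P) volume)
    (hQ : LocallyIntegrable (B.indicator Q) volume)
    {η : E2 → ℝ} (hη : ContDiff ℝ (⊤ : ℕ∞) η) (hηc : HasCompactSupport η) {x : E2}
    (hx : ∀ t ∈ tsupport η, x - t ∈ B) :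
    fderiv ℝ (moll η (B.indicator P)) x (e2 0) + fderiv ℝ (moll η (B.indicator Q)) x (e2 1) = 0 := by
  obtain ⟨D₁, hD₁, hD₁'⟩ := hasFDerivAt_moll hη hηc hP x
  obtain ⟨D₂, hD₂, hD₂'⟩ := hasFDerivAt_moll hη hηc hQ x
  rw [hD₁.fderiv, hD₂.fderiv, (hD₁' _).2, (hD₂' _).2, ← integral_add (hD₁' _).1 (hD₂' _).1]
  set φ : E2 → ℝ := fun y => η (x - y) with hφ
  have hts : ∀ y, y ∈ tsupport φ → x - y ∈ tsupport η := by
    intro y hy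
    have h1 : tsupport φ ⊆ (fun y => x - y) ⁻¹' tsupport η := by
      apply closure_minimal
      · intro z hz
        exact subset_tsupport _ hz
      · exact (isClosed_tsupport η).preimage (by fun_prop)
    exact h1 hy
  have hφt : IsTestOn Ω φ := by
    refine ⟨hη.comp (by fun_prop), ?_, ?_⟩
    · exact hηc.comp_homeomorph (Homeomorph.subLeft x)
    · intro y hy
      have := hx _ (hts y hy)
      rw [sub_sub_cancel] at this
      exact hB this
  have hd : ∀ y u, fderiv ℝ φ y u = - fderiv ℝ η (x - y) u := by
    intro y u
    have h1 : HasFDerivAt η (fderiv ℝ η (x - y)) (x - y) :=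
      (hη.differentiable (by simp)).differentiableAt.hasFDerivAt
    have h2 : HasFDerivAt (fun y => x - y) (-(ContinuousLinearMap.id ℝ E2)) y := by
      simpa using (hasFDerivAt_id y).const_sub x
    have h3 : HasFDerivAt φ _ y := h1.comp y h2
    rw [h3.fderiv]
    simp
  have key := h φ hφt
  rw [← integral_indicator hΩ.measurableSet] at key
  rw [← integral_sub_left_eq_self (fun t => fderiv ℝ η t (e2 0) * B.indicator P (x - t) +
    fderiv ℝ η t (e2 1) * B.indicator Q (x - t)) volume x]
  rw [← neg_eq_zero, ← integral_neg, ← key]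
  congr 1
  ext y
  rw [sub_sub_cancel]
  by_cases hy : y ∈ B
  · rw [indicator_of_mem hy, indicator_of_mem hy, indicator_of_mem (hB hy), hd, hd]
    ring
  · have hny : x - y ∉ tsupport η := by
      intro hc
      have := hx _ hc
      rw [sub_sub_cancel] at this
      exact hy this
    have h0 : fderiv ℝ η (x - y) = 0 :=
      image_eq_zero_of_notMem_tsupport (fun hh => hny (tsupport_fderiv_subset ℝ hh))
    rw [indicator_of_notMem hy, indicator_of_notMem hy]
    by_cases hyΩ : y ∈ Ω
    · rw [indicator_of_mem hyΩ, hd, hd, h0]; simp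
    · rw [indicator_of_notMem hyΩ]; simp

/-- The rotated one-form. -/
def rot (p q : ℝ) : E2 →L[ℝ] ℝ :=
  p • (EuclideanSpace.proj 1 : E2 →L[ℝ] ℝ) - q • (EuclideanSpace.proj 0 : E2 →L[ℝ] ℝ)

lemma rot_apply (p q : ℝ) (u : E2) : rot p q u = p * u 1 - q * u 0 := by
  simp [rot]

lemma e2_decomp (u : E2) : u = u 0 • e2 0 + u 1 • e2 1 := by
  ext i
  fin_cases i <;> simp [e2]

lemma rot_sub_norm (p q p' q' : ℝ) : ‖rot p q - rot p' q'‖ ≤ |p - p'| + |q - q'| := by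
  apply ContinuousLinearMap.opNorm_le_bound _ (by positivity)
  intro u
  rw [_root_.sub_apply, rot_apply, rot_apply]
  have h1 : |u 1| ≤ ‖u‖ := by simpa using PiLp.norm_apply_le u 1
  have h0 : |u 0| ≤ ‖u‖ := by simpa using PiLp.norm_apply_le u 0
  have : p * u 1 - q * u 0 - (p' * u 1 - q' * u 0) = (p - p') * u 1 - (q - q') * u 0 := by ring
  rw [this, Real.norm_eq_abs]
  calc |(p - p') * u 1 - (q - q') * u 0| ≤ |(p - p') * u 1| + |(q - q') * u 0| := abs_sub _ _
    _ = |p - p'| * |u 1| + |q - q'| * |u 0| := by rw [abs_mul, abs_mul]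
    _ ≤ |p - p'| * ‖u‖ + |q - q'| * ‖u‖ := by gcongr
    _ = _ := by ring

/-- Poincaré lemma in the smooth case. -/
lemma stream_smooth {p q : E2 → ℝ} (hp : ContDiff ℝ 1 p) (hq : ContDiff ℝ 1 q) {x₀ : E2} {r : ℝ}
    (h : ∀ x ∈ Metric.ball x₀ r, fderiv ℝ p x (e2 0) + fderiv ℝ q x (e2 1) = 0) :
    ∃ v : E2 → ℝ, v x₀ = 0 ∧ ∀ x ∈ Metric.ball x₀ r, HasFDerivAt v (rot (p x) (q x)) x := by
  have hder : ∀ x, HasFDerivAt (fun x => rot (p x) (q x))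
      ((fderiv ℝ p x).smulRight (EuclideanSpace.proj 1 : E2 →L[ℝ] ℝ) -
        (fderiv ℝ q x).smulRight (EuclideanSpace.proj 0 : E2 →L[ℝ] ℝ)) x := by
    intro x
    have h1 := ((hp.differentiable (by simp)) x).hasFDerivAt.smul_const
      (EuclideanSpace.proj 1 : E2 →L[ℝ] ℝ)
    have h2 := ((hq.differentiable (by simp)) x).hasFDerivAt.smul_const
      (EuclideanSpace.proj 0 : E2 →L[ℝ] ℝ)
    exact h1.sub h2
  obtain ⟨v, hv⟩ := Convex.exists_forall_hasFDerivAt_of_fderiv_symmetric (𝕜 := ℝ)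
    (ω := fun x => rot (p x) (q x)) (convex_ball x₀ r) Metric.isOpen_ball
    (fun x _ => (hder x).differentiableAt.differentiableWithinAt) (by
      intro x hx u w
      rw [(hder x).fderiv]
      have hD := h x hx
      have eu : ∀ (L : E2 →L[ℝ] ℝ) (u : E2), L u = u 0 * L (e2 0) + u 1 * L (e2 1) := by
        intro L u
        conv_lhs => rw [e2_decomp u]
        simp
      simp
      rw [eu (fderiv ℝ p x) u, eu (fderiv ℝ q x) u, eu (fderiv ℝ p x) w, eu (fderiv ℝ q x) w]
      linear_combination (u 0 * w 1 - u 1 * w 0) * hD)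
  refine ⟨fun x => v x - v x₀, by simp, fun x hx => ?_⟩
  exact (hv x hx).sub_const _

end SH

namespace SH
open Filter

lemma moll_close {P : E2 → ℝ} {x₀ : E2} {ρ : ℝ} (hP : ContinuousOn P (Metric.closedBall x₀ (2 * ρ)))
    {ε : ℝ} (hε : 0 < ε) (hρ : 0 < ρ) : ∃ d > 0, ∀ φ : ContDiffBump (0 : E2), φ.rOut < d →
      φ.rOut ≤ ρ → ∀ x ∈ Metric.ball x₀ ρ,
      |moll (φ.normed volume) ((Metric.closedBall x₀ (2 * ρ)).indicator P) x - P x| ≤ ε := by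
  have huc := (isCompact_closedBall x₀ (2 * ρ)).uniformContinuousOn_of_continuous hP
  obtain ⟨d, hd, hd'⟩ := Metric.uniformContinuousOn_iff.1 huc ε hε
  refine ⟨d, hd, fun φ hφd hφρ x hx => ?_⟩
  have hxm : x ∈ Metric.closedBall x₀ (2 * ρ) := by
    rw [Metric.mem_ball] at hx
    rw [Metric.mem_closedBall]
    linarith
  have hmeas : AEStronglyMeasurable ((Metric.closedBall x₀ (2 * ρ)).indicator P) volume :=
    (hP.integrableOn_compact (isCompact_closedBall x₀ (2 * ρ))).integrable_indicator
      measurableSet_closedBall |>.aestronglyMeasurable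
  have := ContDiffBump.dist_normed_convolution_le (φ := φ) (μ := volume) (x₀ := x) (ε := ε) hmeas (by
    intro y hy
    have hym : y ∈ Metric.closedBall x₀ (2 * ρ) := by
      rw [Metric.mem_ball] at hx hy
      rw [Metric.mem_closedBall]
      linarith [dist_triangle y x x₀]
    rw [indicator_of_mem hym, indicator_of_mem hxm]
    rw [Metric.mem_ball] at hy
    exact (hd' y hym x hxm (hy.trans hφd)).le)
  rw [indicator_of_mem hxm, Real.dist_eq] at this
  exact this

/-- Existence of the stream function. -/
lemma stream {Ω : Set E2} (hΩ : IsOpen Ω) {P Q : E2 → ℝ} (hP : ContinuousOn P Ω)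
    (hQ : ContinuousOn Q Ω)
    (h : ∀ φ, IsTestOn Ω φ →
      ∫ x in Ω, (P x * fderiv ℝ φ x (e2 0) + Q x * fderiv ℝ φ x (e2 1)) = 0)
    {x₀ : E2} {ρ : ℝ} (hρ : 0 < ρ) (hB : Metric.closedBall x₀ (2 * ρ) ⊆ Ω) :
    ∃ v : E2 → ℝ, ∀ x ∈ Metric.ball x₀ ρ, HasFDerivAt v (rot (P x) (Q x)) x := by
  set B := Metric.closedBall x₀ (2 * ρ) with hBdef
  have hPB := hP.mono hB
  have hQB := hQ.mono hB
  have hPi : LocallyIntegrable (B.indicator P) volume :=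
    ((hPB.integrableOn_compact (isCompact_closedBall x₀ (2 * ρ))).integrable_indicator
      measurableSet_closedBall).locallyIntegrable
  have hQi : LocallyIntegrable (B.indicator Q) volume :=
    ((hQB.integrableOn_compact (isCompact_closedBall x₀ (2 * ρ))).integrable_indicator
      measurableSet_closedBall).locallyIntegrable
  set φ : ℕ → ContDiffBump (0 : E2) := fun n =>
    { rIn := ρ / (n + 1) / 2
      rOut := ρ / (n + 1)
      rIn_pos := by positivity
      rIn_lt_rOut := by have : 0 < ρ / (n + 1) := by positivity
                        linarith } with hφ
  have hφr : ∀ n, (φ n).rOut = ρ / (n + 1) := fun n => rfl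
  have hφρ : ∀ n, (φ n).rOut ≤ ρ := by
    intro n
    rw [hφr]
    apply div_le_self hρ.le
    linarith [n.cast_nonneg (α := ℝ)]
  have hφ0 : Tendsto (fun n => (φ n).rOut) atTop (𝓝 0) := by
    simp only [hφr]
    have := (tendsto_one_div_add_atTop_nhds_zero_nat (𝕜 := ℝ)).const_mul ρ
    simpa [div_eq_mul_inv] using this
  set p : ℕ → E2 → ℝ := fun n => moll ((φ n).normed volume) (B.indicator P) with hp
  set q : ℕ → E2 → ℝ := fun n => moll ((φ n).normed volume) (B.indicator Q) with hq
  have hsm : ∀ n, ContDiff ℝ (⊤ : ℕ∞) ((φ n).normed volume) := fun n => (φ n).contDiff_normed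
  have hcs : ∀ n, HasCompactSupport ((φ n).normed volume) := fun n => (φ n).hasCompactSupport_normed
  have hv : ∀ n, ∃ v : E2 → ℝ, v x₀ = 0 ∧
      ∀ x ∈ Metric.ball x₀ ρ, HasFDerivAt v (rot (p n x) (q n x)) x := by
    intro n
    apply stream_smooth (contDiff_moll (hsm n) (hcs n) hPi) (contDiff_moll (hsm n) (hcs n) hQi)
    intro x hx
    apply moll_div hΩ h hB hPi hQi (hsm n) (hcs n)
    intro t ht
    rw [ContDiffBump.tsupport_normed_eq, mem_closedBall_zero_iff] at ht
    rw [Metric.mem_ball, dist_eq_norm] at hx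
    rw [hBdef, mem_closedBall_iff_norm]
    have := norm_sub_le (x - x₀) t
    have e : x - t - x₀ = x - x₀ - t := by abel
    rw [e]
    linarith [hφρ n]
  choose v hv0 hv using hv
  have hunif : TendstoUniformlyOn (fun n x => rot (p n x) (q n x)) (fun x => rot (P x) (Q x)) atTop
      (Metric.ball x₀ ρ) := by
    rw [Metric.tendstoUniformlyOn_iff]
    intro ε hε
    obtain ⟨d₁, hd₁, h1⟩ := moll_close hPB (ε := ε / 3) (by positivity) hρ
    obtain ⟨d₂, hd₂, h2⟩ := moll_close hQB (ε := ε / 3) (by positivity) hρ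
    filter_upwards [hφ0.eventually_lt_const hd₁, hφ0.eventually_lt_const hd₂] with n hn1 hn2 x hx
    rw [dist_comm, dist_eq_norm]
    have a1 := h1 (φ n) hn1 (hφρ n) x hx
    have a2 := h2 (φ n) hn2 (hφρ n) x hx
    refine (rot_sub_norm _ _ _ _).trans_lt ?_
    have : |p n x - P x| + |q n x - Q x| ≤ ε / 3 + ε / 3 := add_le_add a1 a2
    linarith
  have hcau := uniformCauchySeqOn_ball_of_fderiv (𝕜 := ℝ) hunif.uniformCauchySeqOn hv (by
    simp only [hv0]
    exact (tendsto_const_nhds (x := (0:ℝ)) (f := atTop (α := ℕ))).cauchy_map)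
  have hlim : ∀ x, ∃ y, x ∈ Metric.ball x₀ ρ → Tendsto (fun n => v n x) atTop (𝓝 y) := by
    intro x
    by_cases hx : x ∈ Metric.ball x₀ ρ
    · obtain ⟨y, hy⟩ := cauchy_map_iff_exists_tendsto.1 (hcau.cauchy_map hx)
      exact ⟨y, fun _ => hy⟩
    · exact ⟨0, fun h => absurd h hx⟩
  choose w hw using hlim
  exact ⟨w, fun x hx => hasFDerivAt_of_tendstoUniformlyOn Metric.isOpen_ball hunif hv hw hx⟩

end SH

namespace SH
open Filter

set_option maxHeartbeats 2000000 in
lemma conf_alg {X Y E F k N a b : ℝ} (hN : 0 ≤ N) (hN2 : N ^ 2 = X ^ 2 + Y ^ 2) (hk : 0 ≤ k)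
    (hk1 : k ≤ 1 / 16) (hE : |E| ≤ k * N) (hF : |F| ≤ k * N) :
    (X * a + Y * b) ^ 2 + ((-Y + F) * a + (X + E) * b) ^ 2 ≤
      (1 + 16 * k) * (X * (X + E) - (-Y + F) * Y) * (a ^ 2 + b ^ 2) := by
  have hX : |X| ≤ N := abs_le_of_sq_le_sq (by nlinarith [sq_nonneg Y]) hN
  have hY : |Y| ≤ N := abs_le_of_sq_le_sq (by nlinarith [sq_nonneg X]) hN
  have hkN : 0 ≤ k * N := by positivity
  have h1 : |X * E| ≤ k * N ^ 2 := by
    rw [abs_mul]; nlinarith [mul_le_mul hX hE (abs_nonneg _) hN]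
  have h2 : |Y * F| ≤ k * N ^ 2 := by
    rw [abs_mul]; nlinarith [mul_le_mul hY hF (abs_nonneg _) hN]
  have hj : (1 - 2 * k) * N ^ 2 ≤ X * (X + E) - (-Y + F) * Y := by
    nlinarith [(abs_le.1 h1).1, (abs_le.1 h2).2]
  have hE2 : E ^ 2 ≤ (k * N) ^ 2 := sq_le_sq' (abs_le.1 hE).1 (abs_le.1 hE).2
  have hF2 : F ^ 2 ≤ (k * N) ^ 2 := sq_le_sq' (abs_le.1 hF).1 (abs_le.1 hF).2
  set W := a ^ 2 + b ^ 2 with hW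
  have hW0 : 0 ≤ W := by positivity
  have hG : (F * a + E * b) ^ 2 ≤ 2 * k ^ 2 * N ^ 2 * W := by
    have : (F * a + E * b) ^ 2 ≤ (F ^ 2 + E ^ 2) * W := by
      nlinarith [sq_nonneg (F * b - E * a)]
    have h3 : (F ^ 2 + E ^ 2) * W ≤ (2 * k ^ 2 * N ^ 2) * W :=
      mul_le_mul_of_nonneg_right (by nlinarith) hW0
    linarith
  have hH : (-Y * a + X * b) ^ 2 ≤ N ^ 2 * W := by
    nlinarith [sq_nonneg (X * a + Y * b)]
  have hc : 2 * (-Y * a + X * b) * (F * a + E * b) ≤ 3 * k * N ^ 2 * W := by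
    rcases hk.eq_or_lt with h0 | h0
    · subst h0
      have : F * a + E * b = 0 := by
        have : (F * a + E * b) ^ 2 ≤ 0 := by simpa using hG
        nlinarith
      rw [this]; simp
    · have h5 : 2 * (-Y * a + X * b) * (F * a + E * b) * k ≤
          k ^ 2 * (-Y * a + X * b) ^ 2 + (F * a + E * b) ^ 2 := by
        nlinarith [sq_nonneg (k * (-Y * a + X * b) - (F * a + E * b))]
      have h6 : k ^ 2 * (-Y * a + X * b) ^ 2 ≤ k ^ 2 * (N ^ 2 * W) :=
        mul_le_mul_of_nonneg_left hH (by positivity)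
      have : 2 * (-Y * a + X * b) * (F * a + E * b) * k ≤ 3 * k * N ^ 2 * W * k := by
        nlinarith
      exact le_of_mul_le_mul_right this h0
  have hNW : 0 ≤ N ^ 2 * W := by positivity
  have hl : (X * a + Y * b) ^ 2 + ((-Y + F) * a + (X + E) * b) ^ 2 ≤ (1 + 4 * k) * (N ^ 2 * W) := by
    have e : (X * a + Y * b) ^ 2 + ((-Y + F) * a + (X + E) * b) ^ 2 =
        N ^ 2 * W + 2 * (-Y * a + X * b) * (F * a + E * b) + (F * a + E * b) ^ 2 := by
      rw [hN2, hW]; ring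
    have h7 : 2 * k ^ 2 * (N ^ 2 * W) ≤ k * (N ^ 2 * W) :=
      mul_le_mul_of_nonneg_right (by nlinarith) hNW
    rw [e]; linarith
  have hr : (1 + 16 * k) * ((1 - 2 * k) * N ^ 2) * W ≤
      (1 + 16 * k) * (X * (X + E) - (-Y + F) * Y) * W := by
    apply mul_le_mul_of_nonneg_right _ hW0
    exact mul_le_mul_of_nonneg_left hj (by positivity)
  have : (1 + 4 * k) * (N ^ 2 * W) ≤ (1 + 16 * k) * (1 - 2 * k) * (N ^ 2 * W) :=
    mul_le_mul_of_nonneg_right (by nlinarith) hNW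
  linarith

lemma norm_alg {A B D a s d : ℝ} (hs : 0 < s) (hs2 : s ^ 2 = A) (hd : 0 < d)
    (hd2 : d ^ 2 = A * D - B ^ 2) :
    ∃ M : ℝ, 0 ≤ M ∧ ∀ η N t00 t01 t10 t11 p q : ℝ, 0 ≤ η → 0 ≤ N →
      N ^ 2 = (s * p + B / s * q) ^ 2 + (d / s * q) ^ 2 →
      |t00 - A| ≤ η → |t01 - (B - a)| ≤ η → |t10 - (B + a)| ≤ η → |t11 - D| ≤ η →
      |1 / d * (s * (-(t10 * p + t11 * q) + a * p) + B / s * (t00 * p + t01 * q + a * q))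
        + d / s * q| ≤ M * η * N ∧
      |d⁻¹ * (d / s * (t00 * p + t01 * q + a * q)) - (s * p + B / s * q)| ≤ M * η * N := by
  set G := (1 / s + |B| / (d * s)) + s / d with hG
  have hG0 : 0 ≤ G := by positivity
  set M1 := (1 / d) * (s + |B| / s) with hM1
  have hM10 : 0 ≤ M1 := by positivity
  have hM2 : 0 ≤ 1 / s := by positivity
  refine ⟨(M1 + 1 / s) * G, by positivity, ?_⟩
  intro η N t00 t01 t10 t11 p q hη hN hN2 h00 h01 h10 h11
  set X := s * p + B / s * q with hX'
  set Y := d / s * q with hY'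
  have hX : |X| ≤ N := abs_le_of_sq_le_sq (by nlinarith [sq_nonneg Y]) hN
  have hY : |Y| ≤ N := abs_le_of_sq_le_sq (by nlinarith [sq_nonneg X]) hN
  have hq : q = s / d * Y := by rw [hY']; field_simp
  have hp : p = 1 / s * X - B / (d * s) * Y := by rw [hX', hY']; field_simp; ring
  have hpq : |p| + |q| ≤ G * N := by
    have h1 : |q| ≤ s / d * N := by
      rw [hq, abs_mul, abs_of_pos (by positivity : 0 < s / d)]
      exact mul_le_mul_of_nonneg_left hY (by positivity)
    have h2 : |p| ≤ 1 / s * N + |B| / (d * s) * N := by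
      rw [hp]
      refine (abs_sub _ _).trans ?_
      rw [abs_mul, abs_mul, abs_div B, abs_of_pos (by positivity : 0 < 1 / s),
        abs_of_pos (by positivity : 0 < d * s)]
      exact add_le_add (mul_le_mul_of_nonneg_left hX (by positivity))
        (mul_le_mul_of_nonneg_left hY (by positivity))
    rw [hG]; linarith
  have hlin : ∀ x y : ℝ, |x| ≤ η → |y| ≤ η → |x * p + y * q| ≤ η * (G * N) := by
    intro x y hx hy
    refine (abs_add_le _ _).trans ?_
    rw [abs_mul, abs_mul]
    have := mul_le_mul_of_nonneg_right hx (abs_nonneg p)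
    have := mul_le_mul_of_nonneg_right hy (abs_nonneg q)
    have := mul_le_mul_of_nonneg_left hpq hη
    linarith
  have l1 := hlin _ _ h00 h01
  have l2 := hlin _ _ h10 h11
  have hGN : 0 ≤ η * (G * N) := by positivity
  constructor
  · have e : 1 / d * (s * (-(t10 * p + t11 * q) + a * p) + B / s * (t00 * p + t01 * q + a * q))
        + Y = 1 / d * (-(s * ((t10 - (B + a)) * p + (t11 - D) * q)) +
          B / s * ((t00 - A) * p + (t01 - (B - a)) * q)) := by
      rw [hY']
      field_simp
      have : s ^ 2 = A := hs2
      subst this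
      linear_combination q * hd2
    rw [e, abs_mul, abs_of_pos (by positivity : 0 < 1 / d)]
    have : |(-(s * ((t10 - (B + a)) * p + (t11 - D) * q)) +
          B / s * ((t00 - A) * p + (t01 - (B - a)) * q))| ≤ (s + |B| / s) * (η * (G * N)) := by
      refine (abs_add_le _ _).trans ?_
      rw [abs_neg, abs_mul, abs_mul, abs_div, abs_of_pos hs]
      have := mul_le_mul_of_nonneg_left l2 hs.le
      have := mul_le_mul_of_nonneg_left l1 (by positivity : 0 ≤ |B| / s)
      linarith
    have h3 := mul_le_mul_of_nonneg_left this (by positivity : 0 ≤ 1 / d)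
    have h4 : 1 / d * ((s + |B| / s) * (η * (G * N))) = M1 * (η * (G * N)) := by rw [hM1]; ring
    have h5 : 0 ≤ 1 / s * (η * (G * N)) := by positivity
    linarith
  · have e : d⁻¹ * (d / s * (t00 * p + t01 * q + a * q)) - X =
        1 / s * ((t00 - A) * p + (t01 - (B - a)) * q) := by
      rw [hX']
      field_simp
      subst hs2
      ring
    rw [e, abs_mul, abs_of_pos (by positivity : 0 < 1 / s)]
    have h3 := mul_le_mul_of_nonneg_left l1 hM2
    have h5 : 0 ≤ M1 * (η * (G * N)) := by positivity
    linarith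

lemma clm_complex (g : ℂ →L[ℝ] ℝ) (w : ℂ) : g w = g 1 * w.re + g Complex.I * w.im := by
  have : w = w.re • (1:ℂ) + w.im • Complex.I := by
    apply Complex.ext <;> simp
  conv_lhs => rw [this]
  rw [map_add, map_smul, map_smul, smul_eq_mul, smul_eq_mul]
  ring

lemma core_real {u v : ℂ → ℝ} {u' v' : ℂ → ℂ →L[ℝ] ℝ} {e : OpenPartialHomeomorph ℂ (ℝ × ℝ)}
    (h0 : (0:ℂ) ∈ e.source) (he : ∀ z ∈ e.source, (e z).1 = u z)
    (hu : ∀ z ∈ e.source, HasFDerivAt u (u' z) z) (hv : ∀ z ∈ e.source, HasFDerivAt v (v' z) z)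
    (hu' : ContinuousOn u' e.source) (hv' : ContinuousOn v' e.source)
    (hu0 : u 0 = 0) (hv0 : v 0 = 0) (hu'0 : u' 0 = 0) {C α : ℝ} (hC : 0 ≤ C) (hα : 0 < α)
    (hsmall : ∀ z ∈ e.source, C * ‖z‖ ^ α ≤ 1 / 16)
    (hb : ∀ z ∈ e.source, ∀ N, 0 ≤ N → N ^ 2 = u' z 1 ^ 2 + u' z Complex.I ^ 2 →
      |v' z 1 + u' z Complex.I| ≤ C * ‖z‖ ^ α * N ∧ |v' z Complex.I - u' z 1| ≤ C * ‖z‖ ^ α * N) :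
    False := by
  set J : ℝ × ℝ →L[ℝ] ℂ := (Complex.equivRealProdCLM.symm : ℝ × ℝ →L[ℝ] ℂ) with hJ
  set f : ℂ → ℂ := fun z => J (u z, v z) with hf
  have hfd : ∀ z ∈ e.source, HasFDerivAt f (J.comp ((u' z).prod (v' z))) z := fun z hz =>
    J.hasFDerivAt.comp z ((hu z hz).prodMk (hv z hz))
  have hre : ∀ x : ℝ × ℝ, (J x).re = x.1 := fun x => by simp [hJ]
  have him : ∀ x : ℝ × ℝ, (J x).im = x.2 := fun x => by simp [hJ]
  have hmain : ∀ z ∈ e.source, ∀ w, ‖fderiv ℝ f z w‖ ^ 2 ≤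
      (1 + 16 * C * ‖z‖ ^ α) * jac f z * ‖w‖ ^ 2 := by
    intro z hz w
    have hk : 0 ≤ C * ‖z‖ ^ α := by positivity
    have hN2 := Real.sq_sqrt (by positivity : 0 ≤ u' z 1 ^ 2 + u' z Complex.I ^ 2)
    obtain ⟨hF, hE⟩ := hb z hz _ (Real.sqrt_nonneg _) hN2
    have := conf_alg (a := w.re) (b := w.im) (Real.sqrt_nonneg _) hN2 hk (hsmall z hz) hE hF
    rw [jac, (hfd z hz).fderiv, Complex.sq_norm, Complex.sq_norm, Complex.normSq_apply,
      Complex.normSq_apply]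
    simp only [ContinuousLinearMap.comp_apply, ContinuousLinearMap.prod_apply, hre, him]
    rw [clm_complex (u' z) w, clm_complex (v' z) w]
    convert this using 1 <;> ring
  have hjac : ∀ z ∈ e.source, 0 ≤ jac f z := by
    intro z hz
    have h1 := hmain z hz 1
    have hk : 0 ≤ C * ‖z‖ ^ α := by positivity
    have h2 : 0 ≤ (1 + 16 * C * ‖z‖ ^ α) * jac f z := by
      have := (sq_nonneg _).trans h1
      simpa using this
    exact nonneg_of_mul_nonneg_right h2 (by nlinarith)
  have H : CoreData f e := by
    refine ⟨fun z hz => by rw [he z hz, hf]; simp [hre], ?_, ?_⟩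
    · have hcf : ContinuousOn (fderiv ℝ f) e.source := by
        have : ContinuousOn (fun z => J.comp ((u' z).prod (v' z))) e.source := by
          have h1 : ContinuousOn (fun z => (u' z).prod (v' z)) e.source := by
            exact (ContinuousLinearMap.prodₗᵢ (𝕜 := ℝ) (E := ℂ) (F := ℝ) (G := ℝ) ℝ).continuous.comp_continuousOn
              (hu'.prodMk hv')
          exact continuousOn_const.clm_comp h1
        exact this.congr fun z hz => (hfd z hz).fderiv
      rw [← zero_add (1 : WithTop ℕ∞), contDiffOn_succ_iff_fderiv_of_isOpen e.open_source]
      exact ⟨fun z hz => (hfd z hz).differentiableAt.differentiableWithinAt, by simp,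
        contDiffOn_zero.2 hcf⟩
    · intro z hz w
      refine (hmain z hz w).trans ?_
      have := hsmall z hz
      apply mul_le_mul_of_nonneg_right _ (sq_nonneg _)
      apply mul_le_mul_of_nonneg_right _ (hjac z hz)
      linarith
  refine H.core_false h0 ?_ ?_ hα (by positivity : 0 ≤ 16 * C) hmain
  · simp only [hf, hu0, hv0]
    exact map_zero J
  · obtain ⟨hF, hE⟩ := hb 0 h0 0 le_rfl (by simp [hu'0])
    have hv'0 : v' 0 = 0 := by
      ext w
      rw [clm_complex]
      simp only [hu'0, mul_zero, abs_nonpos_iff] at hF hE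
      simp at hF hE
      simp [hF, hE]
    rw [(hfd 0 h0).fderiv, hu'0, hv'0]
    ext w
    simp only [ContinuousLinearMap.comp_apply, ContinuousLinearMap.prod_apply,
      ContinuousLinearMap.zero_apply]
    exact map_zero J
end SH

namespace SH
open Filter

lemma plane_false {u v : E2 → ℝ} {u' : E2 → E2 →L[ℝ] ℝ} {τ : E2 → Matrix (Fin 2) (Fin 2) ℝ}
    {V : Set E2} (hV : IsOpen V) {x0 : E2} (hx0 : x0 ∈ V)
    (hu : ∀ x ∈ V, HasFDerivAt u (u' x) x) (hu' : ContinuousOn u' V) (hu'0 : u' x0 = 0)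
    (hτ : ∀ i j, ContinuousOn (fun x => τ x i j) V)
    (hv : ∀ x ∈ V, HasFDerivAt v (rot (τ x 0 0 * u' x (e2 0) + τ x 0 1 * u' x (e2 1))
      (τ x 1 0 * u' x (e2 0) + τ x 1 1 * u' x (e2 1))) x)
    {C α : ℝ} (hC : 0 ≤ C) (hα : 0 < α)
    (hH : ∀ i j, ∀ x ∈ V, |τ x i j - τ x0 i j| ≤ C * dist x x0 ^ α)
    (hA : 0 < τ x0 0 0)
    (hdet : 0 < τ x0 0 0 * τ x0 1 1 - ((τ x0 0 1 + τ x0 1 0) / 2) ^ 2)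
    (e : OpenPartialHomeomorph E2 (ℝ × ℝ)) (hes : x0 ∈ e.source)
    (he : ∀ x ∈ e.source, (e x).1 = u x) : False := by
  set A := τ x0 0 0 with hAdef
  set D := τ x0 1 1 with hDdef
  set B := (τ x0 0 1 + τ x0 1 0) / 2 with hB
  set a := (τ x0 1 0 - τ x0 0 1) / 2 with ha
  set s := √A with hs'
  set d := √(A * D - B ^ 2) with hd'
  have hs : 0 < s := Real.sqrt_pos.2 hA
  have hd : 0 < d := Real.sqrt_pos.2 hdet
  have hs2 : s ^ 2 = A := Real.sq_sqrt hA.le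
  have hd2 : d ^ 2 = A * D - B ^ 2 := Real.sq_sqrt hdet.le
  obtain ⟨M, hM, hMb⟩ := norm_alg (a := a) hs hs2 hd hd2
  set c0 : E2 := s • e2 0 + (B / s) • e2 1 with hc0
  set c1 : E2 := (d / s) • e2 1 with hc1
  have c00 : c0 0 = s := by simp [hc0, e2]
  have c01 : c0 1 = B / s := by simp [hc0, e2]
  have c10 : c1 0 = 0 := by simp [hc1, e2]
  have c11 : c1 1 = d / s := by simp [hc1, e2]
  set L : ℂ →L[ℝ] E2 := Complex.reCLM.smulRight c0 + Complex.imCLM.smulRight c1 with hL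
  have hLa : ∀ z : ℂ, L z = z.re • c0 + z.im • c1 := fun z => by simp [hL]
  have hL1 : L 1 = c0 := by simp [hLa]
  have hLI : L Complex.I = c1 := by simp [hLa]
  let T : ℂ ≃ₜ E2 :=
    { toFun := fun z => x0 + L z
      invFun := fun x => ⟨(x 0 - x0 0) / s,
        ((x 1 - x0 1) - B / s * ((x 0 - x0 0) / s)) * (s / d)⟩
      left_inv := by
        intro z
        apply Complex.ext
        · simp [hLa, c00, c10]
          field_simp
        · simp [hLa, c00, c10, c01, c11]
          field_simp
          ring
      right_inv := by
        intro x
        ext i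
        fin_cases i
        · simp [hLa, c00, c10]
          field_simp
          ring
        · simp [hLa, c00, c10, c01, c11]
          field_simp
          ring
      continuous_toFun := by fun_prop
      continuous_invFun := by
        have : (fun x : E2 => (⟨(x 0 - x0 0) / s,
          ((x 1 - x0 1) - B / s * ((x 0 - x0 0) / s)) * (s / d)⟩ : ℂ)) =
          fun x : E2 => Complex.equivRealProdCLM.symm ((x 0 - x0 0) / s,
          ((x 1 - x0 1) - B / s * ((x 0 - x0 0) / s)) * (s / d)) := by
          funext x
          apply Complex.ext <;> simp
        rw [this]
        fun_prop }
  have hT : ∀ z, T z = x0 + L z := fun z => rfl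
  have hT0 : T 0 = x0 := by simp [hT]
  have hTd : ∀ z, HasFDerivAt (fun z => T z) L z := fun z => by
    simp only [hT]
    exact L.hasFDerivAt.const_add x0
  set C' := M * (C * ‖L‖ ^ α) with hC'
  have hC'0 : 0 ≤ C' := by positivity
  set W : Set ℂ := T ⁻¹' V ∩ {z | C' * ‖z‖ ^ α < 1 / 16} with hW
  have hWo : IsOpen W := by
    refine (hV.preimage T.continuous).inter (isOpen_lt ?_ continuous_const)
    exact continuous_const.mul (continuous_norm.rpow_const fun _ => Or.inr hα.le)
  let S : ℝ × ℝ ≃ₜ ℝ × ℝ := Homeomorph.addRight (-u x0, 0)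
  let e' : OpenPartialHomeomorph ℂ (ℝ × ℝ) :=
    ((T.toOpenPartialHomeomorph.trans e).trans S.toOpenPartialHomeomorph).restrOpen W hWo
  have hsrc : ∀ z, z ∈ e'.source ↔ T z ∈ e.source ∧ z ∈ W := by
    intro z
    simp [e']
  have hev : ∀ z, (e' z).1 = (e (T z)).1 - u x0 := by
    intro z
    simp [e', S, sub_eq_add_neg]
  set r : E2 → E2 →L[ℝ] ℝ := fun x => rot (τ x 0 0 * u' x (e2 0) + τ x 0 1 * u' x (e2 1))
      (τ x 1 0 * u' x (e2 0) + τ x 1 1 * u' x (e2 1)) with hr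
  have hrc : ContinuousOn r V := by
    have h0 : ContinuousOn (fun x => u' x (e2 0)) V := hu'.clm_apply continuousOn_const
    have h1 : ContinuousOn (fun x => u' x (e2 1)) V := hu'.clm_apply continuousOn_const
    have hrot : Continuous (fun pq : ℝ × ℝ => rot pq.1 pq.2) := by
      unfold rot
      fun_prop
    exact hrot.comp_continuousOn
      ((((hτ 0 0).mul h0).add ((hτ 0 1).mul h1)).prodMk (((hτ 1 0).mul h0).add ((hτ 1 1).mul h1)))
  have hWV : ∀ z ∈ e'.source, T z ∈ V := fun z hz => ((hsrc z).1 hz).2.1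
  have hTc : ContinuousOn (fun z => T z) e'.source := T.continuous.continuousOn
  refine core_real (u := fun z => u (T z) - u x0)
    (v := fun z => d⁻¹ * ((v (T z) + a * u (T z)) - (v x0 + a * u x0)))
    (u' := fun z => (u' (T z)).comp L)
    (v' := fun z => d⁻¹ • ((r (T z)).comp L + a • (u' (T z)).comp L)) (e := e') (C := C') (α := α)
    ?_ ?_ ?_ ?_ ?_ ?_ ?_ ?_ ?_ hC'0 hα ?_ ?_
  · rw [hsrc, hT0]
    refine ⟨hes, ?_, ?_⟩
    · simpa [hT0] using hx0
    · simp [Real.zero_rpow hα.ne']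
  · intro z hz
    rw [hev, he _ ((hsrc z).1 hz).1]
  · intro z hz
    exact ((hu _ (hWV z hz)).comp z (hTd z)).sub_const _
  · intro z hz
    have h1 := (hu _ (hWV z hz)).comp z (hTd z)
    have h2 := (hv _ (hWV z hz)).comp z (hTd z)
    exact ((h2.add (h1.const_mul a)).sub_const _).const_mul d⁻¹
  · exact (hu'.comp hTc hWV).clm_comp continuousOn_const
  · have h1 : ContinuousOn (fun z => (u' (T z)).comp L) e'.source :=
      (hu'.comp hTc hWV).clm_comp continuousOn_const
    have h2 : ContinuousOn (fun z => (r (T z)).comp L) e'.source :=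
      (hrc.comp hTc hWV).clm_comp continuousOn_const
    exact (h2.add (h1.const_smul a)).const_smul d⁻¹
  · simp [hT0]
  · simp [hT0]
  · simp [hT0, hu'0]
  · intro z hz
    exact le_of_lt ((hsrc z).1 hz).2.2
  · intro z hz N hN hN2
    set p := u' (T z) (e2 0) with hp
    set q := u' (T z) (e2 1) with hq
    have hu0 : u' (T z) c0 = s * p + B / s * q := by simp [hc0, hp, hq]
    have hu1 : u' (T z) c1 = d / s * q := by simp [hc1, hq]
    have hdist : ∀ i j, |τ (T z) i j - τ x0 i j| ≤ C * ‖L‖ ^ α * ‖z‖ ^ α := by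
      intro i j
      refine (hH i j _ (hWV z hz)).trans ?_
      rw [mul_assoc, ← Real.mul_rpow (norm_nonneg _) (norm_nonneg _)]
      apply mul_le_mul_of_nonneg_left _ hC
      apply Real.rpow_le_rpow dist_nonneg _ hα.le
      rw [hT, dist_eq_norm, add_sub_cancel_left]
      exact L.le_opNorm z
    simp only [ContinuousLinearMap.comp_apply, ContinuousLinearMap.smul_apply,
      ContinuousLinearMap.add_apply, hL1, hLI, smul_eq_mul, hr, rot_apply, c00, c01, c10, c11,
      hu0, hu1] at hN2 ⊢
    have e1 : B - a = τ x0 0 1 := by rw [hB, ha]; ring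
    have e3 : B + a = τ x0 1 0 := by rw [hB, ha]; ring
    obtain ⟨k1, k2⟩ := hMb (C * ‖L‖ ^ α * ‖z‖ ^ α) N (τ (T z) 0 0) (τ (T z) 0 1) (τ (T z) 1 0)
      (τ (T z) 1 1) p q (by positivity) hN hN2 (hdist 0 0) (by rw [e1]; exact hdist 0 1)
      (by rw [e3]; exact hdist 1 0) (hdist 1 1)
    have e4 : M * (C * ‖L‖ ^ α * ‖z‖ ^ α) * N = C' * ‖z‖ ^ α * N := by rw [hC']; ring
    rw [e4] at k1 k2
    constructor
    · convert k1 using 2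
      ring
    · convert k2 using 2
      ring
end SH

namespace SH
open Filter

/-- The linear change of coordinates in the target. -/
def tgt (a b : ℝ) (h : 0 < a ^ 2 + b ^ 2) : E2 ≃ₜ ℝ × ℝ where
  toFun y := (a * y 0 + b * y 1, -b * y 0 + a * y 1)
  invFun w := !₂[(a * w.1 - b * w.2) / (a ^ 2 + b ^ 2), (b * w.1 + a * w.2) / (a ^ 2 + b ^ 2)]
  left_inv y := by
    ext i
    fin_cases i
    · simp
      field_simp
      ring
    · simp
      field_simp
      ring
  right_inv w := by
    ext
    · simp
      field_simp
      ring
    · simp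
      field_simp
      ring
  continuous_toFun := by fun_prop
  continuous_invFun := by
    refine (PiLp.continuous_toLp 2 _).comp (continuous_pi fun i => ?_)
    fin_cases i
    · simp
      fun_prop
    · simp
      fun_prop

end SH

/-- **Theorem (main).** Let `Ω ⊆ ℝ²` be a simply connected open set and `σ` a (possibly
non-symmetric) `2×2` matrix field on `Ω`, uniformly elliptic with constant `K ≥ 1`
(`σξ·ξ ≥ K⁻¹|ξ|²` and `σ⁻¹ξ·ξ ≥ K⁻¹|ξ|²`), whose entries are locally `α`-Hölder continuous
in `Ω` for some `α ∈ (0,1)`.  Let `U = (u¹,u²)` be a `σ`-harmonic mapping, i.e. each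
component `uⁱ = U·eᵢ` is a weak solution of `div(σ∇uⁱ) = 0` in `Ω`
(the `C¹` regularity of `U` is automatic from elliptic regularity with Hölder coefficients,
and is assumed here so that the gradients are classical).  If `U` is locally a homeomorphism
on `Ω`, then it is locally a diffeomorphism, that is `det DU(x) ≠ 0` for every `x ∈ Ω`. -/
theorem sigma_harmonic_local_homeo_is_local_diffeo
    (Ω : Set E2) (hΩopen : IsOpen Ω) (hΩsc : SimplyConnectedSpace Ω)
    (K : ℝ) (hK : 1 ≤ K)
    (σ : E2 → Matrix (Fin 2) (Fin 2) ℝ)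
    (hell : ∀ x ∈ Ω, ∀ ξ : Fin 2 → ℝ,
      K⁻¹ * (ξ 0 ^ 2 + ξ 1 ^ 2) ≤ ∑ i, (σ x).mulVec ξ i * ξ i ∧
      K⁻¹ * (ξ 0 ^ 2 + ξ 1 ^ 2) ≤ ∑ i, (σ x)⁻¹.mulVec ξ i * ξ i)
    (α : ℝ≥0) (hα0 : 0 < α) (hα1 : α < 1)
    (hHolder : ∀ i j : Fin 2, ∀ x ∈ Ω, ∃ s ∈ 𝓝[Ω] x, ∃ C : ℝ≥0,
      HolderOnWith C α (fun y => σ y i j) s)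
    (U : E2 → E2) (hUreg : ContDiffOn ℝ 1 U Ω)
    (hsol : ∀ i : Fin 2, ∀ φ : E2 → ℝ, IsTestOn Ω φ →
      ∫ x in Ω, ∑ k, (∑ j, σ x k j * fderiv ℝ (fun y => U y i) x (e2 j)) *
        fderiv ℝ φ x (e2 k) = 0)
    (hhomeo : IsLocalHomeomorphOn U Ω) :
    ∀ x ∈ Ω, LinearMap.det (fderiv ℝ U x : E2 →ₗ[ℝ] E2) ≠ 0 := by
  intro x0 hx0 hdet
  -- a functional killing the range of the differential
  obtain ⟨g, hg0, hg⟩ := Submodule.exists_le_ker_of_lt_top _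
    (LinearMap.range_lt_top_of_det_eq_zero hdet)
  set a := g (e2 0) with ha
  set b := g (e2 1) with hb
  have hgy : ∀ y : E2, g y = a * y 0 + b * y 1 := by
    intro y
    conv_lhs => rw [SH.e2_decomp y]
    simp only [map_add, map_smul, smul_eq_mul, ha, hb]
    ring
  have hab : 0 < a ^ 2 + b ^ 2 := by
    by_contra hcon
    have h1 : a = 0 := by nlinarith [sq_nonneg a, sq_nonneg b]
    have h2 : b = 0 := by nlinarith [sq_nonneg a, sq_nonneg b]
    apply hg0
    ext y
    simp [hgy, h1, h2]
  -- regularity of the components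
  have hUd : ∀ x ∈ Ω, HasFDerivAt U (fderiv ℝ U x) x := fun x hx =>
    ((hUreg.differentiableOn (by norm_num)).differentiableAt (hΩopen.mem_nhds hx)).hasFDerivAt
  have hUc : ContinuousOn (fderiv ℝ U) Ω := hUreg.continuousOn_fderiv_of_isOpen hΩopen le_rfl
  have hUi : ∀ i : Fin 2, ∀ x ∈ Ω, HasFDerivAt (fun y => U y i)
      ((EuclideanSpace.proj i : E2 →L[ℝ] ℝ).comp (fderiv ℝ U x)) x := fun i x hx =>
    (EuclideanSpace.proj i : E2 →L[ℝ] ℝ).hasFDerivAt.comp x (hUd x hx)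
  have hUif : ∀ i : Fin 2, ∀ x ∈ Ω, ∀ w, fderiv ℝ (fun y => U y i) x w = fderiv ℝ U x w i := by
    intro i x hx w
    rw [(hUi i x hx).fderiv]
    rfl
  have hσc : ∀ i j, ContinuousOn (fun x => σ x i j) Ω := by
    intro i j x hx
    obtain ⟨s, hs, C, hC⟩ := hHolder i j x hx
    exact ((hC.continuousOn hα0) x (mem_of_mem_nhdsWithin hx hs)).mono_of_mem_nhdsWithin hs
  have hDc : ∀ i j : Fin 2, ContinuousOn (fun x => fderiv ℝ (fun y => U y i) x (e2 j)) Ω := by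
    intro i j
    have h1 : ContinuousOn (fun x => (EuclideanSpace.proj i : E2 →L[ℝ] ℝ) (fderiv ℝ U x (e2 j))) Ω :=
      (EuclideanSpace.proj i : E2 →L[ℝ] ℝ).continuous.comp_continuousOn
        (hUc.clm_apply continuousOn_const)
    exact h1.congr fun x hx => hUif i x hx _
  -- common Hölder neighbourhood
  choose s hs Cc hCc using fun i j => hHolder i j x0 hx0
  have hnh : (Ω ∩ ⋂ i, ⋂ j, s i j) ∈ 𝓝 x0 := by
    refine Filter.inter_mem (hΩopen.mem_nhds hx0) ?_
    refine Filter.iInter_mem.2 fun i => Filter.iInter_mem.2 fun j => ?_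
    have := hs i j
    rwa [hΩopen.nhdsWithin_eq hx0] at this
  obtain ⟨R, hR, hRs⟩ := Metric.mem_nhds_iff.1 hnh
  set ρ := R / 3 with hρ'
  have hρ : 0 < ρ := by positivity
  have hcb : Metric.closedBall x0 (2 * ρ) ⊆ Ω := fun y hy =>
    (hRs (Metric.closedBall_subset_ball (by linarith) hy)).1
  have hball : Metric.ball x0 ρ ⊆ Metric.ball x0 R := Metric.ball_subset_ball (by linarith)
  have hbΩ : Metric.ball x0 ρ ⊆ Ω := fun y hy => (hRs (hball hy)).1
  -- stream functions
  have hst : ∀ i : Fin 2, ∃ v : E2 → ℝ, ∀ x ∈ Metric.ball x0 ρ, HasFDerivAt v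
      (SH.rot (σ x 0 0 * fderiv ℝ (fun y => U y i) x (e2 0)
          + σ x 0 1 * fderiv ℝ (fun y => U y i) x (e2 1))
        (σ x 1 0 * fderiv ℝ (fun y => U y i) x (e2 0)
          + σ x 1 1 * fderiv ℝ (fun y => U y i) x (e2 1))) x := by
    intro i
    refine SH.stream hΩopen
      (((hσc 0 0).mul (hDc i 0)).add ((hσc 0 1).mul (hDc i 1)))
      (((hσc 1 0).mul (hDc i 0)).add ((hσc 1 1).mul (hDc i 1))) ?_ hρ hcb
    intro φ hφ
    have := hsol i φ hφ
    simp only [Fin.sum_univ_two] at this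
    exact this
  choose v hv using hst
  -- ellipticity at the point
  have hK0 : 0 < K⁻¹ := by positivity
  have hel : ∀ p q : ℝ, K⁻¹ * (p ^ 2 + q ^ 2) ≤
      σ x0 0 0 * p ^ 2 + (σ x0 0 1 + σ x0 1 0) * (p * q) + σ x0 1 1 * q ^ 2 := by
    intro p q
    have := (hell x0 hx0 ![p, q]).1
    simp [Fin.sum_univ_two, Matrix.mulVec, dotProduct] at this
    linarith
  have hA : 0 < σ x0 0 0 := by
    have := hel 1 0
    norm_num at this
    linarith
  have hdd : 0 < σ x0 0 0 * σ x0 1 1 - ((σ x0 0 1 + σ x0 1 0) / 2) ^ 2 := by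
    have h1 := hel ((σ x0 0 1 + σ x0 1 0) / 2) (-σ x0 0 0)
    have h2 : 0 < K⁻¹ * (((σ x0 0 1 + σ x0 1 0) / 2) ^ 2 + (-σ x0 0 0) ^ 2) := by
      rw [neg_sq]
      positivity
    have h3 : 0 < σ x0 0 0 * (σ x0 0 0 * σ x0 1 1 - ((σ x0 0 1 + σ x0 1 0) / 2) ^ 2) := by
      nlinarith
    exact pos_of_mul_pos_right h3 hA.le
  -- local homeomorphism
  obtain ⟨e, hxe, heU⟩ := hhomeo x0 hx0
  set G : E2 →L[ℝ] ℝ := a • (EuclideanSpace.proj 0 : E2 →L[ℝ] ℝ) +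
    b • (EuclideanSpace.proj 1 : E2 →L[ℝ] ℝ) with hG
  have hGy : ∀ y : E2, G y = a * y 0 + b * y 1 := fun y => by simp [hG]
  refine SH.plane_false (u := fun x => G (U x)) (v := fun x => a * v 0 x + b * v 1 x)
    (u' := fun x => G.comp (fderiv ℝ U x)) (τ := σ) (V := Metric.ball x0 ρ) (x0 := x0)
    (C := ∑ i, ∑ j, (Cc i j : ℝ)) (α := (α : ℝ)) Metric.isOpen_ball (Metric.mem_ball_self hρ)
    ?_ ?_ ?_ (fun i j => (hσc i j).mono hbΩ) ?_ (by positivity) (by exact_mod_cast hα0) ?_ hA hdd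
    (e.trans (SH.tgt a b hab).toOpenPartialHomeomorph) (by simpa using hxe) ?_
  · intro x hx
    exact G.hasFDerivAt.comp x (hUd x (hbΩ hx))
  · exact continuousOn_const.clm_comp (hUc.mono hbΩ)
  · ext w
    have h1 : fderiv ℝ U x0 w ∈ LinearMap.ker g := hg ⟨w, rfl⟩
    rw [LinearMap.mem_ker, hgy] at h1
    rw [ContinuousLinearMap.comp_apply, hGy, h1]
    rfl
  · intro x hx
    have h := ((hv 0 x hx).const_mul a).add ((hv 1 x hx).const_mul b)
    refine HasFDerivAt.congr_fderiv h ?_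
    ext w
    simp only [ContinuousLinearMap.comp_apply, _root_.add_apply, _root_.smul_apply, smul_eq_mul,
      SH.rot_apply, hGy, hUif _ x (hbΩ hx)]
    ring
  · intro i j x hx
    have hx' := mem_iInter.1 (mem_iInter.1 (hRs (hball hx)).2 i) j
    have hx0' := mem_iInter.1 (mem_iInter.1 (hRs (Metric.mem_ball_self hR)).2 i) j
    have h1 := (hCc i j).dist_le hx' hx0'
    rw [Real.dist_eq] at h1
    refine h1.trans ?_
    apply mul_le_mul_of_nonneg_right _ (by positivity)
    refine le_trans ?_ (Finset.single_le_sum (f := fun i => ∑ j, (Cc i j : ℝ))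
      (fun i _ => by positivity) (Finset.mem_univ i))
    exact Finset.single_le_sum (f := fun j => (Cc i j : ℝ))
      (fun j _ => by positivity) (Finset.mem_univ j)
  · intro x hx
    simp [SH.tgt, hGy, heU]
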